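/- arXiv:1402.4635 — 3 statements merged into one kernel-verified Lean document; each statement's English description precedes it below -/
import Mathlib

section
/- There exists a constant A > 0 such that for all D > 0 and ε > 0 there is a constant C = C(D, ε) > 0 with the following property: for all real numbers a, b, c, d, e, f with a > 0 and 4ac − b² ≥ D, and all δ > 0, the set {(x, y) ∈ ℤ² : |a x² + b x y + c y² + d x + e y + f| < δ} is finite with cardinality at most C · (Z^ε + δ^(1/7) · Z^A), where Z = δ + 1 + H and H = max(|a|, |b|, |c|, |d|, |e|, |f|). -/
/-- The divisor bound: the number of divisors of `n` is `O(n ^ ε)` for every `ε > 0`. -/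
theorem exists_card_divisors_le_rpow (ε : ℝ) (hε : 0 < ε) :
    ∃ C : ℝ, 0 < C ∧ ∀ n : ℕ, n ≠ 0 → (n.divisors.card : ℝ) ≤ C * (n : ℝ) ^ ε := by
  have hlog : 0 < Real.log 2 := Real.log_pos (by norm_num)
  set c : ℝ := 1 + 1 / (ε * Real.log 2) with hc
  have hc1 : 1 ≤ c := by
    have : 0 < 1 / (ε * Real.log 2) := by positivity
    linarith
  obtain ⟨B, hB⟩ := exists_nat_ge ((2 : ℝ) ^ (1 / ε))
  refine ⟨c ^ B, by positivity, fun n hn => ?_⟩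
  have key : ∀ p ∈ n.primeFactors, ((n.factorization p : ℝ) + 1) ≤
      (if p < B then c else 1) * ((p : ℝ) ^ ε) ^ n.factorization p := by
    intro p hp
    have hp2 : (2 : ℝ) ≤ p := by exact_mod_cast (Nat.prime_of_mem_primeFactors hp).two_le
    set k := n.factorization p
    split_ifs with hpB
    · have h1 : ((2 : ℝ) ^ ε) ^ k ≤ ((p : ℝ) ^ ε) ^ k := by gcongr
      have h2 : 1 + (k : ℝ) * (ε * Real.log 2) ≤ ((2 : ℝ) ^ ε) ^ k := by
        rw [← Real.rpow_natCast, ← Real.rpow_mul (by norm_num), Real.rpow_def_of_pos (by norm_num)]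
        have := Real.add_one_le_exp (Real.log 2 * (ε * k))
        linarith
      calc (k : ℝ) + 1 ≤ c * (1 + (k : ℝ) * (ε * Real.log 2)) := by
            have h3 : 1 / (ε * Real.log 2) * ((k : ℝ) * (ε * Real.log 2)) = k := by
              field_simp
            have h4 : 0 ≤ 1 / (ε * Real.log 2) := by positivity
            have h5 : 0 ≤ (k : ℝ) * (ε * Real.log 2) := by positivity
            rw [hc]
            linarith
        _ ≤ c * ((p : ℝ) ^ ε) ^ k := by gcongr; linarith
    · have h1 : (2 : ℝ) ≤ (p : ℝ) ^ ε := by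
        have h3 : (2 : ℝ) ^ (1 / ε) ≤ p := hB.trans (by exact_mod_cast not_lt.mp hpB)
        calc (2 : ℝ) = ((2 : ℝ) ^ (1 / ε)) ^ ε := by
              rw [← Real.rpow_mul (by norm_num), one_div_mul_cancel hε.ne', Real.rpow_one]
          _ ≤ _ := by gcongr
      have h2 : ((k : ℝ) + 1) ≤ 2 ^ k := by exact_mod_cast Nat.lt_two_pow_self
      rw [one_mul]
      exact h2.trans (by gcongr)
  rw [Nat.card_divisors hn]
  push_cast
  refine (Finset.prod_le_prod (fun i _ => by positivity) key).trans ?_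
  rw [Finset.prod_mul_distrib]
  have h1 : ∏ p ∈ n.primeFactors, (if p < B then c else 1) ≤ c ^ B := by
    rw [Finset.prod_ite, Finset.prod_const_one, mul_one, Finset.prod_const]
    refine pow_le_pow_right₀ hc1 ?_
    calc _ ≤ (Finset.range B).card := Finset.card_le_card fun p hp => by
          simpa using (Finset.mem_filter.mp hp).2
      _ = B := Finset.card_range B
  have h2 : ∏ p ∈ n.primeFactors, ((p : ℝ) ^ ε) ^ n.factorization p = (n : ℝ) ^ ε := by
    conv_rhs => rw [← Nat.prod_factorization_pow_eq_self hn]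
    rw [Finsupp.prod, Nat.support_factorization, Nat.cast_prod,
      ← Real.finsetProd_rpow _ _ (fun i _ => by positivity)]
    refine Finset.prod_congr rfl fun p _ => ?_
    push_cast
    rw [← Real.rpow_natCast, ← Real.rpow_natCast, ← Real.rpow_mul (by positivity),
      ← Real.rpow_mul (by positivity), mul_comm]
  rw [h2]
  gcongr

lemma isCoprime_of_add_mul_sq {N Δ w u : ℤ} (h : w ^ 2 + Δ * u ^ 2 = N) (hc : IsCoprime w u) :
    IsCoprime u N := by
  have h1 : IsCoprime u (w ^ 2 + u * (Δ * u)) := (hc.symm.pow_right).add_mul_left_right _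
  rwa [show w ^ 2 + u * (Δ * u) = N by rw [← h]; ring] at h1

lemma exists_sqrt_neg_mod {N Δ w u : ℤ} (h : w ^ 2 + Δ * u ^ 2 = N) (hc : IsCoprime w u) :
    ∃ t : ℤ, N ∣ w - t * u ∧ N ∣ t ^ 2 + Δ := by
  have hu := isCoprime_of_add_mul_sq h hc
  obtain ⟨a, b, hab⟩ := id hu
  have h1 : N ∣ w - w * a * u := ⟨w * b, by linear_combination -w * hab⟩
  refine ⟨w * a, h1, ?_⟩
  have h2 : N ∣ u ^ 2 * ((w * a) ^ 2 + Δ) := by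
    have : u ^ 2 * ((w * a) ^ 2 + Δ) = N - (w - w * a * u) * (w + w * a * u) := by
      linear_combination h
    rw [this]
    exact (dvd_refl N).sub (h1.mul_right _)
  exact (IsCoprime.pow_right (n := 2) hu.symm).dvd_of_dvd_mul_left h2

lemma gcd_eq_implies_dvd_two_mul {N Δ w₀ u₀ w₁ u₁ w₂ u₂ : ℤ} (hN : N ≠ 0)
    (hsq : ∀ s : ℤ, s ^ 2 ∣ N → s ^ 2 ∣ Δ → IsUnit s)
    (h₀ : w₀ ^ 2 + Δ * u₀ ^ 2 = N) (hc₀ : IsCoprime w₀ u₀)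
    (h₁ : w₁ ^ 2 + Δ * u₁ ^ 2 = N) (hc₁ : IsCoprime w₁ u₁)
    (h₂ : w₂ ^ 2 + Δ * u₂ ^ 2 = N) (hc₂ : IsCoprime w₂ u₂)
    (hg : Int.gcd (w₁ * u₀ - w₀ * u₁) N = Int.gcd (w₂ * u₀ - w₀ * u₂) N) :
    N ∣ 2 * (w₁ * u₂ - w₂ * u₁) := by
  obtain ⟨t₀, ht₀, hs₀⟩ := exists_sqrt_neg_mod h₀ hc₀
  have hu₀ := isCoprime_of_add_mul_sq h₀ hc₀
  set h : ℤ := (Int.gcd (w₁ * u₀ - w₀ * u₁) N : ℤ) with hh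
  have hhN : h ∣ N := Int.gcd_dvd_right ..
  obtain ⟨n, hn⟩ := hhN
  have hh0 : h ≠ 0 := by rintro h0; rw [h0, zero_mul] at hn; exact hN hn
  have main : ∀ w u t : ℤ, w ^ 2 + Δ * u ^ 2 = N → IsCoprime w u → N ∣ w - t * u → N ∣ t ^ 2 + Δ →
      (Int.gcd (w * u₀ - w₀ * u) N : ℤ) = h → h ∣ t - t₀ ∧ n ∣ t + t₀ := by
    intro w u t hw hc ht hs hgc
    have hu := isCoprime_of_add_mul_sq hw hc
    have hα : N ∣ (w * u₀ - w₀ * u) - (t - t₀) * (u * u₀) := by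
      have : (w * u₀ - w₀ * u) - (t - t₀) * (u * u₀)
        = (w - t * u) * u₀ - (w₀ - t₀ * u₀) * u := by ring
      rw [this]
      exact (ht.mul_right _).sub (ht₀.mul_right _)
    have hhα : h ∣ w * u₀ - w₀ * u := hgc ▸ Int.gcd_dvd_left ..
    constructor
    · have h1 : h ∣ (t - t₀) * (u * u₀) := by
        have := hhα.sub ((Dvd.intro n hn.symm).trans hα)
        simpa using this
      have h2 : IsCoprime h (u * u₀) :=
        ((hu.mul_left hu₀).symm).of_isCoprime_of_dvd_left (Dvd.intro n hn.symm)
      exact h2.dvd_of_dvd_mul_right h1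
    · obtain ⟨a, ha⟩ := hhα
      have hcop : IsCoprime a n := by
        have hd : (Int.gcd (w * u₀ - w₀ * u) N : ℤ) = Int.gcd a n * |h| := by
          rw [ha, hn, Int.gcd_mul_left]
          push_cast
          ring
        rw [hgc, abs_of_nonneg (by positivity)] at hd
        rw [Int.isCoprime_iff_gcd_eq_one]
        have : (Int.gcd a n : ℤ) = 1 := by
          apply mul_right_cancel₀ hh0
          linarith
        exact_mod_cast this
      have h1 : N ∣ (w * u₀ - w₀ * u) * (t + t₀) := by
        have : (w * u₀ - w₀ * u) * (t + t₀) =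
            ((w * u₀ - w₀ * u) - (t - t₀) * (u * u₀)) * (t + t₀)
              + ((t ^ 2 + Δ) - (t₀ ^ 2 + Δ)) * (u * u₀) := by ring
        rw [this]
        exact (hα.mul_right _).add ((hs.sub hs₀).mul_right _)
      rw [ha, hn, mul_assoc] at h1
      exact hcop.symm.dvd_of_dvd_mul_left (Int.dvd_of_mul_dvd_mul_left hh0 h1)
  obtain ⟨t₁, ht₁, hs₁⟩ := exists_sqrt_neg_mod h₁ hc₁
  obtain ⟨t₂, ht₂, hs₂⟩ := exists_sqrt_neg_mod h₂ hc₂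
  obtain ⟨a₁, b₁⟩ := main w₁ u₁ t₁ h₁ hc₁ ht₁ hs₁ rfl
  obtain ⟨a₂, b₂⟩ := main w₂ u₂ t₂ h₂ hc₂ ht₂ hs₂ (by rw [hh, hg])
  have ha : h ∣ t₁ - t₂ := by simpa using a₁.sub a₂
  have hb : n ∣ t₁ - t₂ := by simpa using b₁.sub b₂
  set q : ℤ := (Int.gcd h n : ℤ) with hq
  have hqh : q ∣ h := Int.gcd_dvd_left ..
  have hqn : q ∣ n := Int.gcd_dvd_right ..
  have hqN : q ^ 2 ∣ N := by rw [hn, sq]; exact mul_dvd_mul hqh hqn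
  have hq2t : q ∣ 2 * t₀ := by
    have := (hqn.trans b₁).sub (hqh.trans a₁)
    rwa [show t₁ + t₀ - (t₁ - t₀) = 2 * t₀ by ring] at this
  have hq4 : q ^ 2 ∣ 4 * Δ := by
    have := ((hqN.trans hs₀).mul_left 4).sub (pow_dvd_pow_of_dvd hq2t 2)
    rwa [show 4 * (t₀ ^ 2 + Δ) - (2 * t₀) ^ 2 = 4 * Δ by ring] at this
  have hq2 : q ∣ 2 := by
    rcases Int.even_or_odd' q with ⟨r, hr | hr⟩
    · have h1 : r ^ 2 ∣ Δ := by
        rw [hr, show (2 * r) ^ 2 = 4 * r ^ 2 by ring] at hq4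
        exact Int.dvd_of_mul_dvd_mul_left (by norm_num) hq4
      have h2 : r ^ 2 ∣ N := (pow_dvd_pow_of_dvd (Dvd.intro_left 2 hr.symm) 2).trans hqN
      rw [hr]
      simpa using mul_dvd_mul_left 2 (hsq r h2 h1).dvd (c := 1)
    · have h1 : IsCoprime (q ^ 2) 4 := by
        have : IsCoprime q 2 := ⟨1, -r, by rw [hr]; ring⟩
        simpa using (this.pow : IsCoprime (q ^ 2) (2 ^ 2))
      exact (hsq q hqN (h1.dvd_of_dvd_mul_left hq4)).dvd
  have hl : (Int.lcm h n : ℤ) ∣ t₁ - t₂ := Int.coe_lcm_dvd ha hb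
  have hNt : N ∣ 2 * (t₁ - t₂) := by
    have h1 : q * (Int.lcm h n : ℤ) ∣ 2 * (t₁ - t₂) := mul_dvd_mul hq2 hl
    have h2 : q * (Int.lcm h n : ℤ) = |N| := by
      rw [hq, ← Nat.cast_mul, Int.gcd_mul_lcm, Nat.cast_mul, Int.natCast_natAbs,
        Int.natCast_natAbs, hn, abs_mul]
    rw [h2] at h1
    exact (abs_dvd _ _).mp h1
  have : 2 * (w₁ * u₂ - w₂ * u₁) = 2 * (t₁ - t₂) * (u₁ * u₂)
      + 2 * ((w₁ - t₁ * u₁) * u₂ - (w₂ - t₂ * u₂) * u₁) := by ring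
  rw [this]
  exact (hNt.mul_right _).add (((ht₁.mul_right _).sub (ht₂.mul_right _)).mul_left _)

lemma card_le_of_dvd_two_mul {N Δ w₁ u₁ : ℤ} (hN : 0 < N) (hΔ : 0 < Δ)
    (h₁ : w₁ ^ 2 + Δ * u₁ ^ 2 = N) (s : Finset (ℤ × ℤ))
    (hs : ∀ p ∈ s, p.1 ^ 2 + Δ * p.2 ^ 2 = N ∧ N ∣ 2 * (w₁ * p.2 - p.1 * u₁)) :
    s.card ≤ 25 := by
  have key : ∀ p ∈ s, ∃ X Y : ℤ, X ^ 2 + Δ * Y ^ 2 = 4 ∧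
      2 * (w₁ * p.1 + Δ * u₁ * p.2) = N * X ∧ 2 * (w₁ * p.2 - p.1 * u₁) = N * Y := by
    intro p hp
    obtain ⟨hp1, Y, hY⟩ := hs p hp
    have e1 : (2 * (w₁ * p.1 + Δ * u₁ * p.2)) ^ 2 + Δ * (2 * (w₁ * p.2 - p.1 * u₁)) ^ 2
        = 4 * N ^ 2 := by
      linear_combination 4 * (p.1 ^ 2 + Δ * p.2 ^ 2) * h₁ + 4 * N * hp1
    have e2 : N ^ 2 ∣ (2 * (w₁ * p.1 + Δ * u₁ * p.2)) ^ 2 :=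
      ⟨4 - Δ * Y ^ 2, by rw [hY] at e1; linear_combination e1⟩
    obtain ⟨X, hX⟩ := (Int.pow_dvd_pow_iff two_ne_zero).mp e2
    refine ⟨X, Y, ?_, hX, hY⟩
    rw [hX, hY] at e1
    have : N ^ 2 ≠ 0 := by positivity
    apply mul_left_cancel₀ this
    linear_combination e1
  choose! X Y hXY hX hY using key
  have hmaps : ∀ p ∈ s, (X p, Y p) ∈ (Finset.Icc (-2 : ℤ) 2 ×ˢ Finset.Icc (-2 : ℤ) 2) := by
    intro p hp
    have h := hXY p hp
    simp only [Finset.mem_product, Finset.mem_Icc]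
    have hx : X p ^ 2 ≤ 2 ^ 2 := by nlinarith [sq_nonneg (Y p)]
    have hy : Y p ^ 2 ≤ 2 ^ 2 := by nlinarith [sq_nonneg (Y p), sq_nonneg (X p)]
    exact ⟨abs_le.mp (abs_le_of_sq_le_sq hx (by norm_num)),
      abs_le.mp (abs_le_of_sq_le_sq hy (by norm_num))⟩
  have hinj : Set.InjOn (fun p => (X p, Y p)) s := by
    intro p hp q hq hpq
    simp only [Prod.mk.injEq] at hpq
    have hW : w₁ * p.1 + Δ * u₁ * p.2 = w₁ * q.1 + Δ * u₁ * q.2 := by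
      have := hX p hp; have := hX q hq; rw [hpq.1] at *; linarith
    have hV : w₁ * p.2 - p.1 * u₁ = w₁ * q.2 - q.1 * u₁ := by
      have := hY p hp; have := hY q hq; rw [hpq.2] at *; linarith
    apply Prod.ext
    · apply mul_left_cancel₀ hN.ne'
      rw [← h₁]
      linear_combination w₁ * hW - Δ * u₁ * hV
    · apply mul_left_cancel₀ hN.ne'
      rw [← h₁]
      linear_combination u₁ * hW + w₁ * hV
  have := Finset.card_le_card_of_injOn _ hmaps hinj
  simpa using this

lemma card_primitive_le_of_squarefree {N Δ : ℤ} (hN : 0 < N) (hΔ : 0 < Δ)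
    (hsq : ∀ r : ℤ, r ^ 2 ∣ N → r ^ 2 ∣ Δ → IsUnit r) (s : Finset (ℤ × ℤ))
    (hs : ∀ p ∈ s, p.1 ^ 2 + Δ * p.2 ^ 2 = N ∧ IsCoprime p.1 p.2) :
    s.card ≤ 25 * N.natAbs.divisors.card := by
  rcases s.eq_empty_or_nonempty with rfl | ⟨p₀, hp₀⟩
  · simp
  obtain ⟨h₀, hc₀⟩ := hs p₀ hp₀
  let φ : ℤ × ℤ → ℕ := fun p => Int.gcd (p.1 * p₀.2 - p₀.1 * p.2) N
  refine Finset.card_le_mul_card_image_of_maps_to (f := φ) (fun p _ => ?_) 25 fun g _ => ?_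
  · rw [Nat.mem_divisors]
    exact ⟨Int.gcd_dvd_natAbs_right .., by omega⟩
  · rcases (s.filter fun p => φ p = g).eq_empty_or_nonempty with h | ⟨p₁, hp₁⟩
    · rw [h]; simp
    rw [Finset.mem_filter] at hp₁
    obtain ⟨h₁, hc₁⟩ := hs p₁ hp₁.1
    refine card_le_of_dvd_two_mul hN hΔ h₁ _ fun p hp => ?_
    rw [Finset.mem_filter] at hp
    obtain ⟨h₂, hc₂⟩ := hs p hp.1
    exact ⟨h₂, gcd_eq_implies_dvd_two_mul hN.ne' hsq h₀ hc₀ h₁ hc₁ h₂ hc₂ (hp₁.2.trans hp.2.symm)⟩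

lemma card_primitive_le (n : ℕ) : ∀ {N Δ : ℤ}, N.natAbs = n → 0 < N → 0 < Δ →
    ∀ s : Finset (ℤ × ℤ), (∀ p ∈ s, p.1 ^ 2 + Δ * p.2 ^ 2 = N ∧ IsCoprime p.1 p.2) →
    s.card ≤ 25 * n.divisors.card := by
  induction n using Nat.strong_induction_on with
  | _ n ih =>
    intro N Δ hn hN hΔ s hs
    by_cases hsq : ∀ r : ℤ, r ^ 2 ∣ N → r ^ 2 ∣ Δ → IsUnit r
    · rw [← hn]
      exact card_primitive_le_of_squarefree hN hΔ hsq s hs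
    push Not at hsq
    obtain ⟨r, ⟨N', hN'⟩, ⟨Δ', hΔ'⟩, hr⟩ := hsq
    have hr0 : r ≠ 0 := by rintro rfl; simp at hN'; omega
    have hr2 : 0 < r ^ 2 := by positivity
    have hr1 : 1 < r ^ 2 := by
      rcases lt_or_eq_of_le (show 1 ≤ r ^ 2 by omega) with h | h
      · exact h
      · exact absurd (IsUnit.of_mul_eq_one r (by rw [← sq, ← h])) hr
    have hN'0 : 0 < N' := by
      rw [hN'] at hN; exact (pos_iff_pos_of_mul_pos hN).mp hr2
    have hΔ'0 : 0 < Δ' := by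
      rw [hΔ'] at hΔ; exact (pos_iff_pos_of_mul_pos hΔ).mp hr2
    have hlt : N'.natAbs < n := by
      have : N' < N := by rw [hN']; nlinarith
      omega
    have hw : ∀ p ∈ s, ∃ w, p.1 = r * w := by
      intro p hp
      have h1 := (hs p hp).1
      have : r ^ 2 ∣ p.1 ^ 2 := ⟨N' - Δ' * p.2 ^ 2, by rw [hN', hΔ'] at h1; linear_combination h1⟩
      exact (Int.pow_dvd_pow_iff two_ne_zero).mp this
    choose! w hw using hw
    have hcard : (s.image fun p => (w p, p.2)).card = s.card := by
      refine Finset.card_image_of_injOn fun p hp q hq hpq => ?_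
      simp only [Prod.mk.injEq] at hpq
      exact Prod.ext (by rw [hw p hp, hw q hq, hpq.1]) hpq.2
    rw [← hcard]
    refine (ih _ hlt rfl hN'0 hΔ'0 _ fun p hp => ?_).trans ?_
    · obtain ⟨q, hq, rfl⟩ := Finset.mem_image.mp hp
      obtain ⟨h1, h2⟩ := hs q hq
      rw [hw q hq] at h1 h2
      refine ⟨?_, h2.of_mul_left_right⟩
      apply mul_left_cancel₀ hr2.ne'
      rw [← hN', ← h1, hΔ']
      ring
    · refine Nat.mul_le_mul_left _ (Finset.card_le_card (Nat.divisors_subset_of_dvd (by omega) ?_))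
      rw [← hn, hN', Int.natAbs_mul]
      exact dvd_mul_left _ _

/-- The number of representations of `N > 0` by the form `w² + Δ u²`, uniformly in `Δ > 0`. -/
theorem card_sq_add_mul_sq_le {N Δ : ℤ} (hN : 0 < N) (hΔ : 0 < Δ) (s : Finset (ℤ × ℤ))
    (hs : ∀ p ∈ s, p.1 ^ 2 + Δ * p.2 ^ 2 = N) :
    s.card ≤ 25 * N.natAbs.divisors.card * N.natAbs.divisors.card := by
  have hpos : ∀ p ∈ s, 0 < Int.gcd p.1 p.2 := by
    intro p hp
    rw [Nat.pos_iff_ne_zero, Ne, Int.gcd_eq_zero_iff]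
    rintro ⟨h1, h2⟩
    have := hs p hp
    rw [h1, h2] at this
    simp at this
    omega
  have hdvd : ∀ p ∈ s, (Int.gcd p.1 p.2 : ℤ) ^ 2 ∣ N := by
    intro p hp
    rw [← hs p hp]
    exact (pow_dvd_pow_of_dvd (Int.gcd_dvd_left ..) 2).add
      ((pow_dvd_pow_of_dvd (Int.gcd_dvd_right ..) 2).mul_left _)
  refine Finset.card_le_mul_card_image_of_maps_to (f := fun p => Int.gcd p.1 p.2)
    (fun p hp => ?_) _ fun g hg => ?_
  · rw [Nat.mem_divisors]
    refine ⟨?_, by omega⟩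
    rw [← Int.natCast_dvd]
    exact (dvd_pow_self _ two_ne_zero).trans (hdvd p hp)
  · rcases (s.filter fun p => Int.gcd p.1 p.2 = g).eq_empty_or_nonempty with h | ⟨p₁, hp₁⟩
    · rw [h]; simp
    rw [Finset.mem_filter] at hp₁
    have hg0 : 0 < (g : ℤ) := by have := hpos p₁ hp₁.1; rw [hp₁.2] at this; exact_mod_cast this
    obtain ⟨N', hN'⟩ := hp₁.2 ▸ hdvd p₁ hp₁.1
    have hg2 : 0 < (g : ℤ) ^ 2 := by positivity
    have hN'0 : 0 < N' := by
      rw [hN'] at hN; exact (pos_iff_pos_of_mul_pos hN).mp hg2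
    have hex : ∀ p ∈ s.filter (fun p => Int.gcd p.1 p.2 = g),
        ∃ q : ℤ × ℤ, p.1 = q.1 * g ∧ p.2 = q.2 * g ∧ IsCoprime q.1 q.2 := by
      intro p hp
      rw [Finset.mem_filter] at hp
      obtain ⟨a, b, hab, ha, hb⟩ := Int.exists_gcd_one (hpos p hp.1)
      rw [hp.2] at ha hb
      exact ⟨(a, b), ha, hb, Int.isCoprime_iff_gcd_eq_one.mpr hab⟩
    choose! ψ hψ1 hψ2 hψ3 using hex
    have hcard : ((s.filter fun p => Int.gcd p.1 p.2 = g).image ψ).card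
        = (s.filter fun p => Int.gcd p.1 p.2 = g).card := by
      refine Finset.card_image_of_injOn fun p hp q hq hpq => ?_
      exact Prod.ext (by rw [hψ1 p hp, hψ1 q hq, hpq]) (by rw [hψ2 p hp, hψ2 q hq, hpq])
    rw [← hcard]
    refine (card_primitive_le N'.natAbs rfl hN'0 hΔ _ fun p hp => ?_).trans ?_
    · obtain ⟨q, hq, rfl⟩ := Finset.mem_image.mp hp
      refine ⟨?_, hψ3 q hq⟩
      have h1 := hs q (Finset.mem_filter.mp hq).1
      rw [hψ1 q hq, hψ2 q hq] at h1
      apply mul_left_cancel₀ hg2.ne'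
      rw [← hN', ← h1]
      ring
    · refine Nat.mul_le_mul_left _ (Finset.card_le_card (Nat.divisors_subset_of_dvd (by omega) ?_))
      rw [hN', Int.natAbs_mul]
      exact dvd_mul_left _ _

/-- Integer points on an ellipse with integer coefficients of size at most `X`. -/
theorem exists_card_ellipse_le (η : ℝ) (hη : 0 < η) :
    ∃ C : ℝ, 0 < C ∧ ∀ (X : ℝ), 1 ≤ X → ∀ Q : Fin 6 → ℤ, (∀ i, |(Q i : ℝ)| ≤ X) →
      0 < 4 * Q 0 * Q 2 - Q 1 ^ 2 → ∀ s : Finset (ℤ × ℤ),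
      (∀ p ∈ s, Q 0 * p.1 ^ 2 + Q 1 * p.1 * p.2 + Q 2 * p.2 ^ 2 + Q 3 * p.1 + Q 4 * p.2 + Q 5 = 0) →
      (s.card : ℝ) ≤ C * X ^ η := by
  obtain ⟨C, hC, hdiv⟩ := exists_card_divisors_le_rpow (η / 8) (by positivity)
  refine ⟨1 + 25 * (C * (34 : ℝ) ^ (η / 8)) ^ 2, by positivity, fun X hX Q hQ hΔ s hs => ?_⟩
  have hXη : 1 ≤ X ^ η := Real.one_le_rpow hX hη.le
  have h0 : Q 0 ≠ 0 := by
    intro h; rw [h] at hΔ; nlinarith [sq_nonneg (Q 1)]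
  set Δ := 4 * Q 0 * Q 2 - Q 1 ^ 2 with hΔd
  set k := 2 * Q 0 * Q 4 - Q 1 * Q 3 with hk
  set N := k ^ 2 - Δ * (4 * Q 0 * Q 5 - Q 3 ^ 2) with hN
  let ψ : ℤ × ℤ → ℤ × ℤ := fun p => (Δ * p.2 + k, 2 * Q 0 * p.1 + Q 1 * p.2 + Q 3)
  have hψ : ∀ p ∈ s, (ψ p).1 ^ 2 + Δ * (ψ p).2 ^ 2 = N := by
    intro p hp
    simp only [ψ, hN, hk, hΔd]
    linear_combination 4 * Q 0 * (4 * Q 0 * Q 2 - Q 1 ^ 2) * hs p hp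
  have hinj : (s.image ψ).card = s.card := by
    refine Finset.card_image_of_injective _ fun p q hpq => ?_
    simp only [ψ, Prod.mk.injEq] at hpq
    have h2 : p.2 = q.2 := mul_left_cancel₀ hΔ.ne' (by linarith [hpq.1])
    refine Prod.ext (mul_left_cancel₀ (mul_ne_zero two_ne_zero h0) ?_) h2
    have := hpq.2
    rw [h2] at this
    linarith
  have him : ∀ p ∈ s.image ψ, p.1 ^ 2 + Δ * p.2 ^ 2 = N := by
    intro p hp
    obtain ⟨q, hq, rfl⟩ := Finset.mem_image.mp hp
    exact hψ q hq
  rw [← hinj]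
  rcases le_or_gt N 0 with hN0 | hN0
  · have : (s.image ψ).card ≤ 1 := by
      refine Finset.card_le_one.mpr fun p hp q hq => ?_
      have aux : ∀ p ∈ s.image ψ, p = (0, 0) := by
        intro p hp
        have h1 := him p hp
        have h2 : p.1 ^ 2 = 0 := by nlinarith [sq_nonneg p.1, sq_nonneg p.2]
        have h3 : p.2 ^ 2 = 0 := by nlinarith [sq_nonneg p.1, sq_nonneg p.2]
        exact Prod.ext (pow_eq_zero_iff two_ne_zero |>.mp h2) (pow_eq_zero_iff two_ne_zero |>.mp h3)
      rw [aux p hp, aux q hq]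
    calc ((s.image ψ).card : ℝ) ≤ 1 := by exact_mod_cast this
      _ ≤ _ := by
        have : 0 ≤ 25 * (C * (34 : ℝ) ^ (η / 8)) ^ 2 * X ^ η := by positivity
        nlinarith
  · have h1 := card_sq_add_mul_sq_le hN0 hΔ _ him
    have hd := hdiv N.natAbs (by omega)
    have hNX : (N.natAbs : ℝ) ≤ 34 * X ^ 4 := by
      have e : (N.natAbs : ℝ) = (N : ℝ) := by
        rw [Nat.cast_natAbs, abs_of_pos hN0]
      rw [e, hN, hk, hΔd]
      push_cast
      have m : ∀ i j, |(Q i : ℝ) * Q j| ≤ X ^ 2 := fun i j => by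
        rw [abs_mul, sq]; exact mul_le_mul (hQ i) (hQ j) (abs_nonneg _) (by linarith)
      have m' : ∀ i j, -(X ^ 2) ≤ (Q i : ℝ) * Q j ∧ (Q i : ℝ) * Q j ≤ X ^ 2 :=
        fun i j => abs_le.mp (m i j)
      have k1 : (2 * (Q 0 : ℝ) * Q 4 - Q 1 * Q 3) ^ 2 ≤ (3 * X ^ 2) ^ 2 := by
        apply sq_le_sq'
        · linarith [(m' 0 4).1, (m' 1 3).2]
        · linarith [(m' 0 4).2, (m' 1 3).1]
      have k2 : |(4 * (Q 0 : ℝ) * Q 2 - Q 1 ^ 2) * (4 * Q 0 * Q 5 - Q 3 ^ 2)|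
          ≤ (5 * X ^ 2) * (5 * X ^ 2) := by
        rw [abs_mul]
        refine mul_le_mul ?_ ?_ (abs_nonneg _) (by positivity)
        · exact abs_le.mpr ⟨by linarith [(m' 0 2).1, (m' 1 1).2], by linarith [(m' 0 2).2, (m' 1 1).1]⟩
        · exact abs_le.mpr ⟨by linarith [(m' 0 5).1, (m' 3 3).2], by linarith [(m' 0 5).2, (m' 3 3).1]⟩
      nlinarith [(abs_le.mp k2).1]
    have hd2 : (N.natAbs.divisors.card : ℝ) ≤ C * (34 : ℝ) ^ (η / 8) * X ^ (η / 2) := by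
      calc (N.natAbs.divisors.card : ℝ) ≤ C * (N.natAbs : ℝ) ^ (η / 8) := hd
        _ ≤ C * (34 * X ^ 4) ^ (η / 8) := by gcongr
        _ = C * (34 : ℝ) ^ (η / 8) * X ^ (η / 2) := by
          rw [Real.mul_rpow (by norm_num) (by positivity), ← Real.rpow_natCast,
            ← Real.rpow_mul (by positivity), mul_assoc]
          congr 3
          push_cast
          ring
    calc ((s.image ψ).card : ℝ)
        ≤ 25 * N.natAbs.divisors.card * N.natAbs.divisors.card := by exact_mod_cast h1
      _ = 25 * (N.natAbs.divisors.card : ℝ) ^ 2 := by ring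
      _ ≤ 25 * (C * (34 : ℝ) ^ (η / 8) * X ^ (η / 2)) ^ 2 := by gcongr
      _ = 25 * (C * (34 : ℝ) ^ (η / 8)) ^ 2 * X ^ η := by
        rw [mul_pow, ← Real.rpow_natCast (X ^ (η / 2)), ← Real.rpow_mul (by positivity)]
        have : η / 2 * ((2 : ℕ) : ℝ) = η := by push_cast; ring
        rw [this]; ring
      _ ≤ _ := by nlinarith

/-- The value at the integer point `p` of the quadratic polynomial with coefficients `P`. -/
def conicEval (P : Fin 6 → ℝ) (p : ℤ × ℤ) : ℝ :=
  P 0 * (p.1 : ℝ) ^ 2 + P 1 * p.1 * p.2 + P 2 * (p.2 : ℝ) ^ 2 + P 3 * p.1 + P 4 * p.2 + P 5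

/-- The values at `p` of the monomials of degree at most two. -/
def monomialsAt (p : ℤ × ℤ) : Fin 6 → ℤ :=
  ![p.1 ^ 2, p.1 * p.2, p.2 ^ 2, p.1, p.2, 1]

/-- Twice the signed area of the triangle `p q r`. -/
def triangleArea (p q r : ℤ × ℤ) : ℤ :=
  (q.1 - p.1) * (r.2 - p.2) - (q.2 - p.2) * (r.1 - p.1)

/-- The square matrix with five rows indexed by points and last row `r`. -/
def conicMatrix (p : Fin 5 → ℤ × ℤ) (r : Fin 6 → ℤ) : Matrix (Fin 6) (Fin 6) ℤ :=
  Matrix.of (Fin.snoc (α := fun _ => Fin 6 → ℤ) (fun i => monomialsAt (p i)) r)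

lemma sum_monomialsAt_mul (P : Fin 6 → ℝ) (p : ℤ × ℤ) :
    ∑ j, (monomialsAt p j : ℝ) * P j = conicEval P p := by
  simp [Fin.sum_univ_six, monomialsAt, conicEval]
  ring

lemma abs_monomialsAt_le {R : ℝ} (hR : 1 ≤ R) {p : ℤ × ℤ} (h1 : |(p.1 : ℝ)| ≤ R)
    (h2 : |(p.2 : ℝ)| ≤ R) (j : Fin 6) : |(monomialsAt p j : ℝ)| ≤ R ^ 2 := by
  have hR' : R ≤ R ^ 2 := by nlinarith
  have hR0 : 0 ≤ R := by linarith
  fin_cases j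
  · simpa [monomialsAt] using sq_le_sq' (by linarith [abs_nonneg (p.1 : ℝ)]) h1
  · simpa [monomialsAt, abs_mul, sq] using mul_le_mul h1 h2 (abs_nonneg _) hR0
  · simpa [monomialsAt] using sq_le_sq' (by linarith [abs_nonneg (p.2 : ℝ)]) h2
  · simpa [monomialsAt] using h1.trans hR'
  · simpa [monomialsAt] using h2.trans hR'
  · simpa [monomialsAt] using hR.trans (le_abs_self R)

lemma abs_det_le {T : ℝ} {M : Matrix (Fin 6) (Fin 6) ℤ} (hM : ∀ i j, |(M i j : ℝ)| ≤ T) :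
    |(M.det : ℝ)| ≤ 720 * T ^ 6 := by
  have h := Matrix.det_le (A := M.map (Int.cast : ℤ → ℝ)) (abv := AbsoluteValue.abs) (x := T)
    (fun i j => by simpa using hM i j)
  rw [← Int.cast_det] at h
  simpa [Nat.factorial] using h

lemma abs_adjugate_le {T : ℝ} (hT : 1 ≤ T) {M : Matrix (Fin 6) (Fin 6) ℤ}
    (hM : ∀ i j, |(M i j : ℝ)| ≤ T) (i j : Fin 6) :
    |(M.adjugate i j : ℝ)| ≤ 720 * T ^ 6 := by
  rw [Matrix.adjugate_apply]
  refine abs_det_le fun a b => ?_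
  rw [Matrix.updateRow_apply]
  split_ifs
  · rw [Pi.single_apply]
    split_ifs
    · simpa using hT
    · simpa using by linarith
  · exact hM a b

lemma det_mul_eq_sum_adjugate_mul (M : Matrix (Fin 6) (Fin 6) ℤ) (P : Fin 6 → ℝ) (j : Fin 6) :
    (M.det : ℝ) * P j = ∑ i, (M.adjugate j i : ℝ) * ∑ k, (M i k : ℝ) * P k := by
  have h : ∀ k, ∑ i, (M.adjugate j i : ℝ) * (M i k : ℝ) = if j = k then (M.det : ℝ) else 0 := by
    intro k
    have := congrFun (congrFun (Matrix.adjugate_mul M) j) k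
    rw [Matrix.mul_apply] at this
    have h2 := congrArg (Int.cast : ℤ → ℝ) this
    push_cast at h2
    rw [h2, Matrix.smul_apply, Matrix.one_apply]
    split_ifs <;> simp
  simp_rw [Finset.mul_sum, ← mul_assoc]
  rw [Finset.sum_comm]
  simp_rw [← Finset.sum_mul, h]
  simp

lemma adjugate_conicMatrix_last (p : Fin 5 → ℤ × ℤ) (r : Fin 6 → ℤ) (j : Fin 6) :
    (conicMatrix p r).adjugate j (Fin.last 5) = (conicMatrix p (Pi.single j 1)).det := by
  rw [Matrix.adjugate_apply]
  exact congrArg (fun M => (Matrix.of M).det)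
    (Fin.update_snoc_last (α := fun _ => Fin 6 → ℤ) r (fun i => monomialsAt (p i)) (Pi.single j 1))

lemma conicMatrix_castSucc (p : Fin 5 → ℤ × ℤ) (r : Fin 6 → ℤ) (i : Fin 5) (j : Fin 6) :
    conicMatrix p r i.castSucc j = monomialsAt (p i) j := by
  simp [conicMatrix]

lemma conicMatrix_last (p : Fin 5 → ℤ × ℤ) (r : Fin 6 → ℤ) (j : Fin 6) :
    conicMatrix p r (Fin.last 5) j = r j := by
  simp only [conicMatrix, Matrix.of_apply, Fin.snoc_last]

lemma det_conicMatrix (p : Fin 5 → ℤ × ℤ) (r : Fin 6 → ℤ) :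
    (conicMatrix p r).det = ∑ j, r j * (conicMatrix p (Pi.single j 1)).det := by
  rw [Matrix.det_eq_sum_mul_adjugate_row _ (Fin.last 5)]
  refine Finset.sum_congr rfl fun j _ => ?_
  rw [adjugate_conicMatrix_last]
  exact congrArg (· * _) (conicMatrix_last p r j)

lemma abs_conicMatrix_le {T : ℝ} {p : Fin 5 → ℤ × ℤ} {r : Fin 6 → ℤ}
    (hp : ∀ i j, |(monomialsAt (p i) j : ℝ)| ≤ T) (hr : ∀ j, |(r j : ℝ)| ≤ T) (i j : Fin 6) :
    |(conicMatrix p r i j : ℝ)| ≤ T := by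
  induction i using Fin.lastCases with
  | last => rw [conicMatrix_last]; exact hr j
  | cast i => rw [conicMatrix_castSucc]; exact hp i j

lemma relation_coeff_eq_zero {p₁ p₂ p₃ p₄ p₅ : ℤ × ℤ} {g₁ g₂ g₃ g₄ g₅ : ℝ}
    (h : ∀ j, g₁ * monomialsAt p₁ j + g₂ * monomialsAt p₂ j + g₃ * monomialsAt p₃ j
      + g₄ * monomialsAt p₄ j + g₅ * monomialsAt p₅ j = 0)
    (h1 : triangleArea p₁ p₂ p₅ ≠ 0) (h2 : triangleArea p₃ p₄ p₅ ≠ 0) : g₅ = 0 := by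
  have e0 := h 0
  have e1 := h 1
  have e2 := h 2
  have e3 := h 3
  have e4 := h 4
  have e5 := h 5
  simp only [monomialsAt, Fin.isValue, Matrix.cons_val, Int.cast_pow, Int.cast_mul,
    Int.cast_one, mul_one] at e0 e1 e2 e3 e4 e5
  have key : g₅ * ((triangleArea p₁ p₂ p₅ : ℝ) * (triangleArea p₃ p₄ p₅ : ℝ)) = 0 := by
    simp only [triangleArea]
    push_cast
    linear_combination ((p₂.2 : ℝ) - p₁.2) * (p₄.2 - p₃.2) * e0
      - (((p₂.2 : ℝ) - p₁.2) * (p₄.1 - p₃.1) + (p₄.2 - p₃.2) * (p₂.1 - p₁.1)) * e1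
      + ((p₂.1 : ℝ) - p₁.1) * (p₄.1 - p₃.1) * e2
      - (((p₂.2 : ℝ) - p₁.2) * (p₃.1 * (p₄.2 - p₃.2) - p₃.2 * (p₄.1 - p₃.1))
        + (p₄.2 - p₃.2) * (p₁.1 * (p₂.2 - p₁.2) - p₁.2 * (p₂.1 - p₁.1))) * e3
      + (((p₂.1 : ℝ) - p₁.1) * (p₃.1 * (p₄.2 - p₃.2) - p₃.2 * (p₄.1 - p₃.1))
        + (p₄.1 - p₃.1) * (p₁.1 * (p₂.2 - p₁.2) - p₁.2 * (p₂.1 - p₁.1))) * e4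
      + ((p₁.1 : ℝ) * (p₂.2 - p₁.2) - p₁.2 * (p₂.1 - p₁.1))
        * (p₃.1 * (p₄.2 - p₃.2) - p₃.2 * (p₄.1 - p₃.1)) * e5
  rcases mul_eq_zero.mp key with h | h
  · exact h
  · rcases mul_eq_zero.mp h with h | h
    · exact absurd (by exact_mod_cast h) h1
    · exact absurd (by exact_mod_cast h) h2

/-- Five points, no three of them collinear, lie on a unique conic. -/
lemma exists_det_conicMatrix_single_ne_zero {p : Fin 5 → ℤ × ℤ}
    (hp : ∀ i j k, i ≠ j → i ≠ k → j ≠ k → triangleArea (p i) (p j) (p k) ≠ 0) :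
    ∃ k, (conicMatrix p (Pi.single k 1)).det ≠ 0 := by
  set v : Fin 5 → Fin 6 → ℝ := fun i j => monomialsAt (p i) j with hv
  have hli : LinearIndependent ℝ v := by
    rw [Fintype.linearIndependent_iff]
    intro g hg
    have h : ∀ j, g 0 * monomialsAt (p 0) j + g 1 * monomialsAt (p 1) j
        + g 2 * monomialsAt (p 2) j + g 3 * monomialsAt (p 3) j + g 4 * monomialsAt (p 4) j = 0 := by
      intro j
      simpa [Fin.sum_univ_five, hv] using congrFun hg j
    intro i
    fin_cases i
    · change g 0 = 0
      exact relation_coeff_eq_zero (fun j => by linarith [h j])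
        (hp 1 2 0 (by decide) (by decide) (by decide)) (hp 3 4 0 (by decide) (by decide) (by decide))
        (g₁ := g 1) (g₂ := g 2) (g₃ := g 3) (g₄ := g 4)
    · change g 1 = 0
      exact relation_coeff_eq_zero (fun j => by linarith [h j])
        (hp 0 2 1 (by decide) (by decide) (by decide)) (hp 3 4 1 (by decide) (by decide) (by decide))
        (g₁ := g 0) (g₂ := g 2) (g₃ := g 3) (g₄ := g 4)
    · change g 2 = 0
      exact relation_coeff_eq_zero (fun j => by linarith [h j])
        (hp 0 1 2 (by decide) (by decide) (by decide)) (hp 3 4 2 (by decide) (by decide) (by decide))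
        (g₁ := g 0) (g₂ := g 1) (g₃ := g 3) (g₄ := g 4)
    · change g 3 = 0
      exact relation_coeff_eq_zero (fun j => by linarith [h j])
        (hp 0 1 3 (by decide) (by decide) (by decide)) (hp 2 4 3 (by decide) (by decide) (by decide))
        (g₁ := g 0) (g₂ := g 1) (g₃ := g 2) (g₄ := g 4)
    · change g 4 = 0
      exact relation_coeff_eq_zero (fun j => by linarith [h j])
        (hp 0 1 4 (by decide) (by decide) (by decide)) (hp 2 3 4 (by decide) (by decide) (by decide))
        (g₁ := g 0) (g₂ := g 1) (g₃ := g 2) (g₄ := g 3)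
  by_contra! hzero
  have hspan : ∀ k : Fin 6, (Pi.single k 1 : Fin 6 → ℝ) ∈ Submodule.span ℝ (Set.range v) := by
    intro k
    by_contra hk
    have hli' : LinearIndependent ℝ (Fin.snoc v (Pi.single k 1) : Fin 6 → Fin 6 → ℝ) :=
      linearIndependent_finSnoc.mpr ⟨hli, hk⟩
    have hrows : (conicMatrix p (Pi.single k 1)).map (Int.cast : ℤ → ℝ)
        = Matrix.of (Fin.snoc v (Pi.single k 1) : Fin 6 → Fin 6 → ℝ) := by
      ext i j
      induction i using Fin.lastCases with
      | last =>
        rw [Matrix.map_apply, conicMatrix_last, Matrix.of_apply, Fin.snoc_last, Pi.single_apply,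
          Pi.single_apply]
        split_ifs <;> simp
      | cast i => rw [Matrix.map_apply, conicMatrix_castSucc, Matrix.of_apply, Fin.snoc_castSucc]
    have hu : IsUnit (Matrix.of (Fin.snoc v (Pi.single k 1) : Fin 6 → Fin 6 → ℝ)) :=
      Matrix.linearIndependent_rows_iff_isUnit.mp hli'
    rw [← hrows, Matrix.isUnit_iff_isUnit_det, ← Int.cast_det, hzero k] at hu
    simp at hu
  have htop : Submodule.span ℝ (Set.range v) = ⊤ := by
    rw [eq_top_iff, ← (Pi.basisFun ℝ (Fin 6)).span_eq, Submodule.span_le]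
    rintro _ ⟨k, rfl⟩
    simpa using hspan k
  have h5 := finrank_range_le_card (R := ℝ) v
  rw [Set.finrank, htop, finrank_top] at h5
  simp at h5

/-- A definite quadratic polynomial cannot be small at three collinear integer points. -/
lemma le_of_collinear_aux {D Z δ R : ℝ} {P : Fin 6 → ℝ} (hP0 : 0 < P 0)
    (hD0 : 0 < D) (hR : 0 ≤ R) (hD : D ≤ 4 * P 0 * P 2 - P 1 ^ 2)
    (h0Z : P 0 ≤ Z) (h2Z : P 2 ≤ Z) {p q r : ℤ × ℤ}
    (hpx : |(p.1 : ℝ)| ≤ R) (hqx : |(q.1 : ℝ)| ≤ R) (hrx : |(r.1 : ℝ)| ≤ R)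
    (hp : |conicEval P p| < δ) (hq : |conicEval P q| < δ) (hr : |conicEval P r| < δ)
    (hpq : p.1 ≠ q.1) (hpr : p ≠ r) (hqr : q ≠ r) (h : triangleArea p q r = 0) :
    D ≤ 48 * Z * R ^ 2 * δ := by
  have hx : ∀ s : ℤ × ℤ, triangleArea p q s = 0 → (p.1 = s.1 → p = s) ∧ (q.1 = s.1 → q = s) := by
    intro s hs
    simp only [triangleArea] at hs
    refine ⟨fun e => Prod.ext e ?_, fun e => Prod.ext e ?_⟩
    · rw [e] at hs hpq
      have : (q.1 - s.1) * (s.2 - p.2) = 0 := by linear_combination hs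
      rcases mul_eq_zero.mp this with h | h
      · exact absurd (by omega) hpq
      · omega
    · rw [e] at hs hpq
      have : (s.1 - p.1) * (s.2 - q.2) = 0 := by linear_combination hs
      rcases mul_eq_zero.mp this with h | h
      · exact absurd (by omega) hpq
      · omega
  have hpr' : p.1 ≠ r.1 := fun e => hpr ((hx r h).1 e)
  have hqr' : q.1 ≠ r.1 := fun e => hqr ((hx r h).2 e)
  set m : ℝ := (q.1 : ℝ) - p.1 with hm
  set n : ℝ := (r.1 : ℝ) - p.1 with hn
  set m' : ℝ := (q.2 : ℝ) - p.2 with hm'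
  have hcol : ((r.2 : ℝ) - p.2) * m = n * m' := by
    have : ((triangleArea p q r : ℤ) : ℝ) = 0 := by exact_mod_cast h
    simp only [triangleArea] at this
    push_cast at this
    rw [hm, hn, hm']
    linarith
  have hone : ∀ a b : ℤ, a ≠ b → 1 ≤ |(b : ℝ) - a| := by
    intro a b hab
    have : 1 ≤ |b - a| := Int.one_le_abs (by omega)
    exact_mod_cast this
  have hm1 : 1 ≤ |m| := hone _ _ hpq
  have hn1 : 1 ≤ |n| := hone _ _ hpr'
  have hnm1 : 1 ≤ |n - m| := by
    have : n - m = (r.1 : ℝ) - q.1 := by rw [hm, hn]; ring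
    rw [this]; exact hone _ _ hqr'
  have hmR : |m| ≤ 2 * R := (abs_sub _ _).trans (by linarith)
  have hnR : |n| ≤ 2 * R := (abs_sub _ _).trans (by linarith)
  have hnmR : |n - m| ≤ 2 * R := by
    have : n - m = (r.1 : ℝ) - q.1 := by rw [hm, hn]; ring
    rw [this]; exact (abs_sub _ _).trans (by linarith)
  set Q : ℝ := P 0 * m ^ 2 + P 1 * m * m' + P 2 * m' ^ 2 with hQ
  have hid : Q * (n * (n - m)) = m ^ 2 * conicEval P r - (n * m) * conicEval P q
      + (m * (n - m)) * conicEval P p := by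
    have e1 : (r.1 : ℝ) = p.1 + n := by rw [hn]; ring
    have e2 : (q.1 : ℝ) = p.1 + m := by rw [hm]; ring
    have e3 : (q.2 : ℝ) = p.2 + m' := by rw [hm']; ring
    obtain ⟨n', e4⟩ : ∃ n' : ℝ, (r.2 : ℝ) = p.2 + n' := ⟨r.2 - p.2, by ring⟩
    rw [e4, add_sub_cancel_left] at hcol
    simp only [conicEval, hQ, e1, e2, e3, e4]
    linear_combination (-(P 1 * m * (p.1 + n)) - P 2 * (2 * p.2 * m + n' * m + n * m') - P 4 * m) * hcol
  have hc2 : 0 < P 2 := by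
    by_contra hneg
    nlinarith [sq_nonneg (P 1)]
  have hQD : D ≤ 4 * Z * Q := by
    have e1 : 4 * P 2 * Q = (2 * P 2 * m' + P 1 * m) ^ 2 + (4 * P 0 * P 2 - P 1 ^ 2) * m ^ 2 := by
      rw [hQ]; ring
    have e2 : 1 ≤ m ^ 2 := (one_le_sq_iff_one_le_abs m).mpr hm1
    have e3 : D ≤ 4 * P 2 * Q := by
      calc D ≤ D * m ^ 2 := le_mul_of_one_le_right hD0.le e2
        _ ≤ (4 * P 0 * P 2 - P 1 ^ 2) * m ^ 2 := by gcongr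
        _ ≤ 4 * P 2 * Q := by rw [e1]; exact le_add_of_nonneg_left (sq_nonneg _)
    have e4 : 0 < Q := (mul_pos_iff_of_pos_left (by positivity)).mp (hD0.trans_le e3)
    exact e3.trans (mul_le_mul_of_nonneg_right (by linarith) e4.le)
  have hZ : 0 < Z := by linarith
  have hQ0 : 0 ≤ Q := ((mul_pos_iff_of_pos_left (by positivity)).mp (hD0.trans_le hQD)).le
  have hQle : Q ≤ 12 * R ^ 2 * δ := by
    have e1 : 1 ≤ |n * (n - m)| := by rw [abs_mul]; exact one_le_mul_of_one_le_of_one_le hn1 hnm1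
    have b : ∀ a b v : ℝ, |a| ≤ 2 * R → |b| ≤ 2 * R → |v| < δ → |a * b * v| ≤ 4 * R ^ 2 * δ := by
      intro a b v ha hb hv
      rw [abs_mul, abs_mul]
      calc |a| * |b| * |v| ≤ (2 * R) * (2 * R) * δ := by gcongr
        _ = _ := by ring
    calc Q ≤ Q * |n * (n - m)| := le_mul_of_one_le_right hQ0 e1
      _ = |Q * (n * (n - m))| := by rw [abs_mul Q, abs_of_nonneg hQ0]
      _ ≤ 12 * R ^ 2 * δ := by
        rw [hid, sq]
        have b1 := abs_le.mp (b m m _ hmR hmR hr)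
        have b2 := abs_le.mp (b n m _ hnR hmR hq)
        have b3 := abs_le.mp (b m (n - m) _ hmR hnmR hp)
        exact abs_le.mpr ⟨by linarith, by linarith⟩
  calc D ≤ 4 * Z * Q := hQD
    _ ≤ 4 * Z * (12 * R ^ 2 * δ) := by gcongr
    _ = 48 * Z * R ^ 2 * δ := by ring

lemma le_of_collinear {D Z δ R : ℝ} {P : Fin 6 → ℝ} (hP0 : 0 < P 0)
    (hD0 : 0 < D) (hR : 0 ≤ R) (hD : D ≤ 4 * P 0 * P 2 - P 1 ^ 2)
    (h0Z : P 0 ≤ Z) (h2Z : P 2 ≤ Z) {p q r : ℤ × ℤ}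
    (hp : |(p.1 : ℝ)| ≤ R ∧ |(p.2 : ℝ)| ≤ R ∧ |conicEval P p| < δ)
    (hq : |(q.1 : ℝ)| ≤ R ∧ |(q.2 : ℝ)| ≤ R ∧ |conicEval P q| < δ)
    (hr : |(r.1 : ℝ)| ≤ R ∧ |(r.2 : ℝ)| ≤ R ∧ |conicEval P r| < δ)
    (hpq : p ≠ q) (hpr : p ≠ r) (hqr : q ≠ r) (h : triangleArea p q r = 0) :
    D ≤ 48 * Z * R ^ 2 * δ := by
  by_cases hx : p.1 = q.1
  · have hy : p.2 ≠ q.2 := fun e => hpq (Prod.ext hx e)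
    have hc2 : 0 < P 2 := by
      by_contra hneg
      nlinarith [sq_nonneg (P 1)]
    have hswap : ∀ s : ℤ × ℤ, conicEval ![P 2, P 1, P 0, P 4, P 3, P 5] s.swap = conicEval P s := by
      intro s
      simp [conicEval]
      ring
    refine le_of_collinear_aux (P := ![P 2, P 1, P 0, P 4, P 3, P 5]) (p := p.swap) (q := q.swap)
      (r := r.swap) hc2 hD0 hR (by simpa using by linarith) h2Z h0Z hp.2.1 hq.2.1 hr.2.1
      (by rw [hswap]; exact hp.2.2) (by rw [hswap]; exact hq.2.2) (by rw [hswap]; exact hr.2.2)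
      hy (fun e => hpr (Prod.swap_injective e)) (fun e => hqr (Prod.swap_injective e)) ?_
    simp only [triangleArea, Prod.fst_swap, Prod.snd_swap] at h ⊢
    linarith
  · exact le_of_collinear_aux hP0 hD0 hR hD h0Z h2Z hp.1 hq.1 hr.1 hp.2.2 hq.2.2 hr.2.2 hx hpr hqr h

lemma abs_le_of_abs_conicEval_lt {D Z δ : ℝ} {P : Fin 6 → ℝ} (hP0 : 0 < P 0)
    (hD0 : 0 < D) (hδ : 0 < δ) (hD : D ≤ 4 * P 0 * P 2 - P 1 ^ 2)
    (hZ : ∀ i, δ + 1 + |P i| ≤ Z) {p : ℤ × ℤ} (hp : |conicEval P p| < δ) :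
    |(p.1 : ℝ)| ≤ (1 + 32 / D) * Z ^ 2 ∧ |(p.2 : ℝ)| ≤ (1 + 32 / D) * Z ^ 2 := by
  have hc2 : 0 < P 2 := by
    by_contra hneg
    nlinarith [sq_nonneg (P 1)]
  have hZ1 : 1 ≤ Z := by linarith [hZ 0, abs_nonneg (P 0)]
  set x : ℝ := (p.1 : ℝ)
  set y : ℝ := (p.2 : ℝ)
  set q : ℝ := P 0 * x ^ 2 + P 1 * x * y + P 2 * y ^ 2 with hq
  have h0Z : P 0 ≤ Z := by linarith [hZ 0, le_abs_self (P 0)]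
  have h2Z : P 2 ≤ Z := by linarith [hZ 2, le_abs_self (P 2)]
  have e1 : D * x ^ 2 ≤ 4 * P 2 * q := by
    calc D * x ^ 2 ≤ (4 * P 0 * P 2 - P 1 ^ 2) * x ^ 2 := by gcongr
      _ ≤ (2 * P 2 * y + P 1 * x) ^ 2 + (4 * P 0 * P 2 - P 1 ^ 2) * x ^ 2 :=
        le_add_of_nonneg_left (sq_nonneg _)
      _ = _ := by rw [hq]; ring
  have e2 : D * y ^ 2 ≤ 4 * P 0 * q := by
    calc D * y ^ 2 ≤ (4 * P 0 * P 2 - P 1 ^ 2) * y ^ 2 := by gcongr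
      _ ≤ (2 * P 0 * x + P 1 * y) ^ 2 + (4 * P 0 * P 2 - P 1 ^ 2) * y ^ 2 :=
        le_add_of_nonneg_left (sq_nonneg _)
      _ = _ := by rw [hq]; ring
  have hq0 : 0 ≤ q :=
    nonneg_of_mul_nonneg_right ((by positivity : 0 ≤ D * x ^ 2).trans e1) (by positivity)
  have e3 : D * (x ^ 2 + y ^ 2) ≤ 8 * Z * q := by
    have := mul_le_mul_of_nonneg_right h0Z hq0
    have := mul_le_mul_of_nonneg_right h2Z hq0
    linarith
  set s : ℝ := |x| + |y| with hs
  have hs0 : 0 ≤ s := by positivity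
  have e4 : q ≤ Z * (1 + s) := by
    have h1 : conicEval P p = q + P 3 * x + P 4 * y + P 5 := by simp only [conicEval, hq, x, y]
    have h2 := (abs_lt.mp hp).2
    have h3 : -(P 3 * x) ≤ Z * |x| := (neg_le_abs _).trans
      (by rw [abs_mul]; gcongr; linarith [hZ 3])
    have h4 : -(P 4 * y) ≤ Z * |y| := (neg_le_abs _).trans
      (by rw [abs_mul]; gcongr; linarith [hZ 4])
    have h5 := neg_le_abs (P 5)
    have := hZ 5
    rw [hs]
    linarith
  have e5 : s ^ 2 ≤ 2 * (x ^ 2 + y ^ 2) := by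
    rw [hs, ← sq_abs x, ← sq_abs y]
    linarith [sq_nonneg (|x| - |y|)]
  have e6 : D * s ^ 2 ≤ 16 * Z ^ 2 * (1 + s) := by
    calc D * s ^ 2 ≤ D * (2 * (x ^ 2 + y ^ 2)) := by gcongr
      _ = 2 * (D * (x ^ 2 + y ^ 2)) := by ring
      _ ≤ 2 * (8 * Z * q) := mul_le_mul_of_nonneg_left e3 zero_le_two
      _ ≤ 2 * (8 * Z * (Z * (1 + s))) := by gcongr
      _ = _ := by ring
  have hZ2 : 1 ≤ Z ^ 2 := one_le_pow₀ hZ1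
  have e7 : s ≤ (1 + 32 / D) * Z ^ 2 := by
    rcases le_or_gt s 1 with h | h
    · have : 0 ≤ 32 / D * Z ^ 2 := by positivity
      linarith
    · have h1 : D * s ≤ 32 * Z ^ 2 := by
        have : s * (D * s) ≤ s * (32 * Z ^ 2) := by
          calc s * (D * s) = D * s ^ 2 := by ring
            _ ≤ 16 * Z ^ 2 * (1 + s) := e6
            _ ≤ 16 * Z ^ 2 * (s + s) := by gcongr
            _ = _ := by ring
        exact le_of_mul_le_mul_left this (by linarith)
      have h2 : s ≤ 32 / D * Z ^ 2 := by
        rw [div_mul_eq_mul_div, le_div_iff₀ hD0]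
        linarith
      linarith
  exact ⟨by linarith [abs_nonneg y], by linarith [abs_nonneg x]⟩

/-- If a definite quadratic polynomial is very small at more than four integer points, these points
lie on an ellipse with integer coefficients. -/
lemma exists_int_conic {D Z δ R : ℝ} {P : Fin 6 → ℝ} (hP0 : 0 < P 0)
    (hD0 : 0 < D) (hδ : 0 < δ) (hD : D ≤ 4 * P 0 * P 2 - P 1 ^ 2)
    (hZ1 : 1 ≤ Z) (hZ : ∀ i, |P i| ≤ Z) (hR : 1 ≤ R) (s : Finset (ℤ × ℤ))
    (hs : ∀ p ∈ s, |(p.1 : ℝ)| ≤ R ∧ |(p.2 : ℝ)| ≤ R ∧ |conicEval P p| < δ)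
    (hsmallD : 90 * (720 * (R ^ 2) ^ 6) ^ 2 * Z * δ < D)
    (hsmall1 : 90 * (720 * (R ^ 2) ^ 6) ^ 2 * Z * δ < 1) (hcard : 4 < s.card) :
    ∃ Q : Fin 6 → ℤ, (∀ i, |(Q i : ℝ)| ≤ 720 * (R ^ 2) ^ 6) ∧ 0 < 4 * Q 0 * Q 2 - Q 1 ^ 2 ∧
      ∀ p ∈ s, Q 0 * p.1 ^ 2 + Q 1 * p.1 * p.2 + Q 2 * p.2 ^ 2 + Q 3 * p.1 + Q 4 * p.2 + Q 5 = 0 := by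
  have hT : 1 ≤ R ^ 2 := one_le_pow₀ hR
  have hTE : R ^ 2 ≤ 720 * (R ^ 2) ^ 6 := by
    have : R ^ 2 ≤ (R ^ 2) ^ 6 := le_self_pow₀ hT (by norm_num)
    linarith
  set T := R ^ 2 with hTdef
  set E := 720 * T ^ 6 with hE
  have hE1 : 1 ≤ E := hT.trans hTE
  have hE2 : E ≤ E ^ 2 := le_self_pow₀ hE1 (by norm_num)
  set θ := 6 * E * δ with hθ
  have hθ0 : 0 < θ := by positivity
  have hEZ : 15 * E * Z * θ < D := by
    calc 15 * E * Z * θ = 90 * E ^ 2 * Z * δ := by rw [hθ]; ring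
      _ < D := hsmallD
  have hθ1 : θ < 1 := by
    refine lt_of_le_of_lt ?_ hsmall1
    calc θ ≤ 90 * E ^ 2 * 1 * δ := by rw [hθ, mul_one]; gcongr; linarith
      _ ≤ _ := by gcongr
  have hEZ1 : 1 ≤ E * Z := one_le_mul_of_one_le_of_one_le hE1 hZ1
  obtain ⟨t, hts, htc⟩ := Finset.exists_subset_card_eq (show 5 ≤ s.card from hcard)
  let e := (t.equivFinOfCardEq htc).symm
  let p : Fin 5 → ℤ × ℤ := fun i => e i
  have hpinj : Function.Injective p := Subtype.val_injective.comp e.injective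
  have hps : ∀ i, p i ∈ s := fun i => hts (e i).2
  have htri : ∀ i j k, i ≠ j → i ≠ k → j ≠ k → triangleArea (p i) (p j) (p k) ≠ 0 := by
    intro i j k hij hik hjk h0
    have := le_of_collinear hP0 hD0 (by linarith) hD ((le_abs_self _).trans (hZ 0))
      ((le_abs_self _).trans (hZ 2)) (hs _ (hps i)) (hs _ (hps j)) (hs _ (hps k))
      (hpinj.ne hij) (hpinj.ne hik) (hpinj.ne hjk) h0
    refine absurd this (not_le.mpr (lt_of_le_of_lt ?_ hsmallD))
    calc 48 * Z * T * δ = 48 * T * Z * δ := by ring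
      _ ≤ 90 * E ^ 2 * Z * δ := by
        have := hTE.trans hE2
        gcongr
        norm_num
  let Q : Fin 6 → ℤ := fun j => (conicMatrix p (Pi.single j 1)).det
  have hmono : ∀ q ∈ s, ∀ j, |(monomialsAt q j : ℝ)| ≤ T := fun q hq j =>
    abs_monomialsAt_le hR (hs q hq).1 (hs q hq).2.1 j
  have hsingle : ∀ k j : Fin 6, |((Pi.single k 1 : Fin 6 → ℤ) j : ℝ)| ≤ T := by
    intro k j
    rw [Pi.single_apply]
    split_ifs
    · simpa using hT
    · simpa using by linarith
  have hQE : ∀ i, |(Q i : ℝ)| ≤ E := fun i =>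
    abs_det_le (abs_conicMatrix_le (fun i => hmono _ (hps i)) (hsingle i))
  have hsmallsum : ∀ r : Fin 6 → ℤ, (∀ j, |(r j : ℝ)| ≤ T) → ∀ j,
      |∑ i : Fin 5, ((conicMatrix p r).adjugate j i.castSucc : ℝ)
        * ∑ k, (conicMatrix p r i.castSucc k : ℝ) * P k| ≤ 5 * E * δ := by
    intro r hr j
    refine (Finset.abs_sum_le_sum_abs _ _).trans ?_
    calc _ ≤ ∑ i : Fin 5, E * δ := by
          refine Finset.sum_le_sum fun i _ => ?_
          rw [abs_mul]
          simp_rw [conicMatrix_castSucc, sum_monomialsAt_mul]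
          refine mul_le_mul ?_ (hs _ (hps i)).2.2.le (abs_nonneg _) (by linarith)
          exact abs_adjugate_le hT (abs_conicMatrix_le (fun i => hmono _ (hps i)) hr) _ _
      _ = 5 * E * δ := by simp; ring
  have hvanish : ∀ q ∈ s, (conicMatrix p (monomialsAt q)).det = 0 := by
    intro q hq
    by_contra hdet
    have hP : ∀ j, |P j| ≤ θ := by
      intro j
      have h1 : (1 : ℝ) ≤ |((conicMatrix p (monomialsAt q)).det : ℝ)| := by
        exact_mod_cast Int.one_le_abs hdet
      have h2 := det_mul_eq_sum_adjugate_mul (conicMatrix p (monomialsAt q)) P j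
      rw [Fin.sum_univ_castSucc] at h2
      have h3 := hsmallsum (monomialsAt q) (hmono q hq) j
      have h4 : |((conicMatrix p (monomialsAt q)).adjugate j (Fin.last 5) : ℝ)
          * ∑ k, (conicMatrix p (monomialsAt q) (Fin.last 5) k : ℝ) * P k| ≤ E * δ := by
        rw [abs_mul]
        simp_rw [conicMatrix_last, sum_monomialsAt_mul]
        refine mul_le_mul ?_ (hs _ hq).2.2.le (abs_nonneg _) (by linarith)
        exact abs_adjugate_le hT (abs_conicMatrix_le (fun i => hmono _ (hps i)) (hmono q hq)) _ _
      calc |P j| ≤ |((conicMatrix p (monomialsAt q)).det : ℝ)| * |P j| :=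
            le_mul_of_one_le_left (abs_nonneg _) h1
        _ = |((conicMatrix p (monomialsAt q)).det : ℝ) * P j| := (abs_mul _ _).symm
        _ ≤ 5 * E * δ + E * δ := by rw [h2]; exact (abs_add_le _ _).trans (add_le_add h3 h4)
        _ = θ := by rw [hθ]; ring
    have h1 : P 0 * P 2 ≤ θ * Z :=
      mul_le_mul ((le_abs_self _).trans (hP 0)) ((le_abs_self _).trans (hZ 2))
        (by by_contra hneg; nlinarith [sq_nonneg (P 1)]) hθ0.le
    have h2 : 4 * (θ * Z) ≤ 15 * E * Z * θ := by
      have : θ * Z * 1 ≤ θ * Z * E := by gcongr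
      have : 0 ≤ θ * Z := by positivity
      linarith
    linarith [sq_nonneg (P 1)]
  have hnear : ∀ k j, |(Q k : ℝ) * P j - Q j * P k| ≤ θ := by
    intro k j
    have h2 := det_mul_eq_sum_adjugate_mul (conicMatrix p (Pi.single k 1)) P j
    rw [Fin.sum_univ_castSucc, adjugate_conicMatrix_last] at h2
    have h3 := hsmallsum (Pi.single k 1) (hsingle k) j
    have h4 : ∑ i, (conicMatrix p (Pi.single k 1) (Fin.last 5) i : ℝ) * P i = P k := by
      simp_rw [conicMatrix_last, Pi.single_apply]
      simp
    rw [h4] at h2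
    have h5 : 5 * E * δ ≤ θ := by rw [hθ]; gcongr; norm_num
    refine le_trans (le_of_eq ?_) (h3.trans h5)
    congr 1
    simp only [Q]
    rw [h2]
    ring
  refine ⟨Q, hQE, ?_, fun q hq => ?_⟩
  · obtain ⟨k, hk⟩ := exists_det_conicMatrix_single_ne_zero htri
    have hQk : (1 : ℝ) ≤ (Q k : ℝ) ^ 2 := by
      rw [one_le_sq_iff_one_le_abs]
      exact_mod_cast Int.one_le_abs (show Q k ≠ 0 from hk)
    obtain ⟨a, ha⟩ : ∃ a, a = (Q k : ℝ) * P 0 - Q 0 * P k := ⟨_, rfl⟩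
    obtain ⟨b, hb⟩ : ∃ b, b = (Q k : ℝ) * P 1 - Q 1 * P k := ⟨_, rfl⟩
    obtain ⟨c, hc⟩ : ∃ c, c = (Q k : ℝ) * P 2 - Q 2 * P k := ⟨_, rfl⟩
    have ha' : |a| ≤ θ := ha ▸ hnear k 0
    have hb' : |b| ≤ θ := hb ▸ hnear k 1
    have hc' : |c| ≤ θ := hc ▸ hnear k 2
    have hid : (Q k : ℝ) ^ 2 * (4 * P 0 * P 2 - P 1 ^ 2)
        = P k ^ 2 * (4 * Q 0 * Q 2 - Q 1 ^ 2)
          + (4 * (a * (Q 2 * P k)) + 4 * (c * (Q 0 * P k)) + 4 * (a * c)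
            - 2 * (b * (Q 1 * P k)) - b * b) := by
      rw [ha, hb, hc]; ring
    have hQP : ∀ j, |(Q j : ℝ) * P k| ≤ E * Z := fun j => by
      rw [abs_mul]; exact mul_le_mul (hQE j) (hZ k) (abs_nonneg _) (by linarith)
    have m1 : ∀ u v : ℝ, |u| ≤ θ → |v| ≤ E * Z → |u * v| ≤ E * Z * θ := fun u v hu hv => by
      rw [abs_mul, mul_comm (E * Z)]; exact mul_le_mul hu hv (abs_nonneg _) hθ0.le
    have hθEZ : θ ≤ E * Z := hθ1.le.trans hEZ1
    have b1 := abs_le.mp (m1 a _ ha' (hQP 2))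
    have b2 := abs_le.mp (m1 c _ hc' (hQP 0))
    have b3 := abs_le.mp (m1 a c ha' (hc'.trans hθEZ))
    have b4 := abs_le.mp (m1 b _ hb' (hQP 1))
    have b5 := abs_le.mp (m1 b b hb' (hb'.trans hθEZ))
    have hlow : D ≤ (Q k : ℝ) ^ 2 * (4 * P 0 * P 2 - P 1 ^ 2) :=
      hD.trans (le_mul_of_one_le_left (hD0.le.trans hD) hQk)
    have hpos : 0 < P k ^ 2 * (4 * (Q 0 : ℝ) * Q 2 - Q 1 ^ 2) := by linarith
    have hpos' : 0 < 4 * (Q 0 : ℝ) * Q 2 - Q 1 ^ 2 := pos_of_mul_pos_right hpos (sq_nonneg _)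
    exact_mod_cast hpos'
  · have h := hvanish q hq
    rw [det_conicMatrix, Fin.sum_univ_six] at h
    simp only [monomialsAt, Matrix.cons_val] at h
    simp only [Q]
    linarith

lemma card_le_of_abs_le {R : ℝ} (hR : 1 ≤ R) (s : Finset (ℤ × ℤ))
    (hs : ∀ p ∈ s, |(p.1 : ℝ)| ≤ R ∧ |(p.2 : ℝ)| ≤ R) : (s.card : ℝ) ≤ 9 * R ^ 2 := by
  have hmem : ∀ z : ℤ, |(z : ℝ)| ≤ R → z ∈ Finset.Icc (-⌊R⌋) ⌊R⌋ := by
    intro z hz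
    rw [abs_le] at hz
    rw [Finset.mem_Icc]
    refine ⟨?_, Int.le_floor.mpr hz.2⟩
    have : -z ≤ ⌊R⌋ := Int.le_floor.mpr (by push_cast; linarith)
    omega
  have hsub : s ⊆ Finset.Icc (-⌊R⌋) ⌊R⌋ ×ˢ Finset.Icc (-⌊R⌋) ⌊R⌋ := fun p hp =>
    Finset.mem_product.mpr ⟨hmem _ (hs p hp).1, hmem _ (hs p hp).2⟩
  have h0 : 0 ≤ ⌊R⌋ := Int.floor_nonneg.mpr (by linarith)
  have hc : ((Finset.Icc (-⌊R⌋) ⌊R⌋).card : ℝ) ≤ 3 * R := by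
    rw [Int.card_Icc]
    have h1 : (((⌊R⌋ + 1 - -⌊R⌋).toNat : ℤ) : ℝ) = 2 * (⌊R⌋ : ℝ) + 1 := by
      rw [Int.toNat_of_nonneg (by omega)]
      push_cast
      ring
    rw [Int.cast_natCast] at h1
    rw [h1]
    linarith [Int.floor_le R]
  calc (s.card : ℝ) ≤ ((Finset.Icc (-⌊R⌋) ⌊R⌋ ×ˢ Finset.Icc (-⌊R⌋) ⌊R⌋).card : ℝ) := by
        exact_mod_cast Finset.card_le_card hsub
    _ ≤ (3 * R) * (3 * R) := by
        rw [Finset.card_product]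
        push_cast
        gcongr
    _ = 9 * R ^ 2 := by ring

lemma coeff_bound_eq (K Z : ℝ) : 720 * ((K * Z ^ 2) ^ 2) ^ 6 = 720 * K ^ 12 * Z ^ 24 := by
  ring

lemma coeff_bound_sq_eq (K Z δ : ℝ) :
    90 * (720 * K ^ 12 * Z ^ 24) ^ 2 * Z * δ = δ * Z ^ 49 * (90 * 720 ^ 2 * K ^ 24) := by
  ring

/-- The count for values of `δ` that are small compared with the coefficients. -/
lemma exists_card_le_of_small (ε : ℝ) (hε : 0 < ε) :
    ∃ C : ℝ, 0 < C ∧ ∀ {D Z δ K : ℝ} {P : Fin 6 → ℝ}, 1 ≤ K → 0 < P 0 → 0 < D → 0 < δ →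
      D ≤ 4 * P 0 * P 2 - P 1 ^ 2 → 1 ≤ Z → (∀ i, |P i| ≤ Z) → ∀ s : Finset (ℤ × ℤ),
      (∀ p ∈ s, |(p.1 : ℝ)| ≤ K * Z ^ 2 ∧ |(p.2 : ℝ)| ≤ K * Z ^ 2 ∧ |conicEval P p| < δ) →
      δ * Z ^ 49 * (90 * 720 ^ 2 * K ^ 24) < min D 1 →
      (s.card : ℝ) ≤ 4 * Z ^ ε ∨ (s.card : ℝ) ≤ C * (720 * K ^ 12) ^ (ε / 24) * Z ^ ε := by
  obtain ⟨C, hC, hell⟩ := exists_card_ellipse_le (ε / 24) (by positivity)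
  refine ⟨C, hC, fun {D Z δ K P} hK1 hP0 hD0 hδ hD hZ1 hPZ s hs hsmall => ?_⟩
  have hZ0 : 0 < Z := by linarith
  have hK0 : 0 < K := by linarith
  rcases le_or_gt s.card 4 with h4 | h4
  · left
    have h : (s.card : ℝ) ≤ 4 := by exact_mod_cast h4
    linarith [Real.one_le_rpow hZ1 hε.le]
  · right
    have hR1 : 1 ≤ K * Z ^ 2 := one_le_mul_of_one_le_of_one_le hK1 (one_le_pow₀ hZ1)
    have hX1 : 1 ≤ 720 * ((K * Z ^ 2) ^ 2) ^ 6 := by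
      have h : 1 ≤ ((K * Z ^ 2) ^ 2) ^ 6 := one_le_pow₀ (one_le_pow₀ hR1)
      linarith
    have hmin : 90 * (720 * ((K * Z ^ 2) ^ 2) ^ 6) ^ 2 * Z * δ < min D 1 := by
      rwa [coeff_bound_eq, coeff_bound_sq_eq]
    obtain ⟨Q, hQ1, hQ2, hQ3⟩ := exists_int_conic hP0 hD0 hδ hD hZ1 hPZ hR1 s hs
      (hmin.trans_le (min_le_left _ _)) (hmin.trans_le (min_le_right _ _)) h4
    have hcount := hell _ hX1 Q hQ1 hQ2 s hQ3
    rw [coeff_bound_eq, Real.mul_rpow (by positivity) (by positivity), ← Real.rpow_natCast Z,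
      ← Real.rpow_mul hZ0.le] at hcount
    have hexp : ((24 : ℕ) : ℝ) * (ε / 24) = ε := by
      push_cast
      ring
    rwa [hexp, ← mul_assoc] at hcount

theorem integral_points_near_definite_conic :
    ∃ A : ℝ, 0 < A ∧
      ∀ D : ℝ, 0 < D → ∀ ε : ℝ, 0 < ε → ∃ C : ℝ, 0 < C ∧
        ∀ a b c d e f : ℝ, 0 < a → D ≤ 4 * a * c - b ^ 2 →
          ∀ δ : ℝ, 0 < δ →
            {p : ℤ × ℤ | |a * (p.1 : ℝ) ^ 2 + b * p.1 * p.2 + c * (p.2 : ℝ) ^ 2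
                + d * p.1 + e * p.2 + f| < δ}.Finite ∧
            (Nat.card {p : ℤ × ℤ | |a * (p.1 : ℝ) ^ 2 + b * p.1 * p.2 + c * (p.2 : ℝ) ^ 2
                + d * p.1 + e * p.2 + f| < δ} : ℝ)
              ≤ C * ((δ + 1 + max (max (max |a| |b|) (max |c| |d|)) (max |e| |f|)) ^ ε
                  + δ ^ ((1 : ℝ)/7)
                    * (δ + 1 + max (max (max |a| |b|) (max |c| |d|)) (max |e| |f|)) ^ A) := by
  refine ⟨11, by norm_num, fun D hD0 ε hε => ?_⟩
  obtain ⟨C₁, hC₁, hsmallcard⟩ := exists_card_le_of_small ε hε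
  set K : ℝ := 1 + 32 / D with hK
  have hK1 : 1 ≤ K := by
    have : 0 < 32 / D := by positivity
    linarith
  have hK0 : 0 < K := by linarith
  set κ : ℝ := min D 1 / (90 * 720 ^ 2 * K ^ 24) with hκ
  have hκ0 : 0 < κ := by positivity
  refine ⟨4 + C₁ * (720 * K ^ 12) ^ (ε / 24) + 9 * K ^ 2 * κ ^ (-(1 / 7 : ℝ)), by positivity,
    fun a b c d e f ha hD δ hδ => ?_⟩
  set Z : ℝ := δ + 1 + max (max (max |a| |b|) (max |c| |d|)) (max |e| |f|) with hZdef
  let P : Fin 6 → ℝ := ![a, b, c, d, e, f]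
  have hPZ : ∀ i, δ + 1 + |P i| ≤ Z := by
    intro i
    rw [hZdef]
    gcongr
    fin_cases i <;> simp [P]
  have hZ1 : 1 ≤ Z := by linarith [hPZ 0, abs_nonneg (P 0)]
  have hZ0 : 0 < Z := by linarith
  set S := {p : ℤ × ℤ | |a * (p.1 : ℝ) ^ 2 + b * p.1 * p.2 + c * (p.2 : ℝ) ^ 2
                + d * p.1 + e * p.2 + f| < δ} with hS
  have hSP : ∀ p ∈ S, |conicEval P p| < δ := fun p hp => by simpa [conicEval, P, hS] using hp
  set R := K * Z ^ 2 with hR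
  have hR1 : 1 ≤ R := one_le_mul_of_one_le_of_one_le hK1 (one_le_pow₀ hZ1)
  have hbd : ∀ p ∈ S, |(p.1 : ℝ)| ≤ R ∧ |(p.2 : ℝ)| ≤ R := fun p hp =>
    abs_le_of_abs_conicEval_lt (P := P) ha hD0 hδ hD hPZ (hSP p hp)
  have hfin : S.Finite := by
    refine ((Set.finite_Icc (-⌈R⌉) ⌈R⌉).prod (Set.finite_Icc (-⌈R⌉) ⌈R⌉)).subset fun p hp => ?_
    obtain ⟨h1, h2⟩ := hbd p hp
    have aux : ∀ z : ℤ, |(z : ℝ)| ≤ R → z ∈ Set.Icc (-⌈R⌉) ⌈R⌉ := by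
      intro z hz
      rw [Set.mem_Icc, ← abs_le]
      exact_mod_cast hz.trans (Int.le_ceil R)
    exact ⟨aux _ h1, aux _ h2⟩
  refine ⟨hfin, ?_⟩
  have hcard : Nat.card S = hfin.toFinset.card := by
    rw [Nat.card_coe_set_eq, Set.ncard_eq_toFinset_card S hfin]
  rw [hcard]
  set s := hfin.toFinset with hs
  have hsS : ∀ p ∈ s, p ∈ S := fun p hp => hfin.mem_toFinset.mp hp
  have hZε : 1 ≤ Z ^ ε := Real.one_le_rpow hZ1 hε.le
  set U := C₁ * (720 * K ^ 12) ^ (ε / 24) with hU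
  set V := 9 * K ^ 2 * κ ^ (-(1 / 7 : ℝ)) with hV
  have hU0 : 0 < U := by positivity
  have hV0 : 0 < V := by positivity
  set W := δ ^ ((1 : ℝ) / 7) * Z ^ (11 : ℝ) with hW
  have hW0 : 0 < W := by positivity
  suffices h : (s.card : ℝ) ≤ 4 * Z ^ ε ∨ (s.card : ℝ) ≤ U * Z ^ ε ∨ (s.card : ℝ) ≤ V * W by
    have hUZ : 0 ≤ U * Z ^ ε := by positivity
    have hVZ : 0 ≤ V * Z ^ ε := by positivity
    have hUW : 0 ≤ U * W := by positivity
    have hVW : 0 ≤ V * W := by positivity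
    rw [mul_add, add_mul, add_mul, add_mul, add_mul]
    rcases h with h | h | h <;> linarith
  rcases le_or_gt κ (δ * Z ^ 49) with hbig | hsmall
  · right; right
    have h1 := card_le_of_abs_le hR1 s fun p hp => hbd p (hsS p hp)
    have h2 : 1 ≤ κ ^ (-(1 / 7 : ℝ)) * (δ ^ ((1 : ℝ) / 7) * Z ^ 7) := by
      have h3 : κ ^ (1 / 7 : ℝ) ≤ (δ * Z ^ 49) ^ (1 / 7 : ℝ) := by gcongr
      have h4 : (δ * Z ^ 49) ^ (1 / 7 : ℝ) = δ ^ ((1 : ℝ) / 7) * Z ^ 7 := by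
        rw [Real.mul_rpow hδ.le (by positivity), ← Real.rpow_natCast, ← Real.rpow_mul hZ0.le,
          ← Real.rpow_natCast]
        norm_num
      rw [Real.rpow_neg hκ0.le, ← h4, ← div_eq_inv_mul, one_le_div (by positivity)]
      exact h3
    calc (s.card : ℝ) ≤ 9 * R ^ 2 := h1
      _ = 9 * K ^ 2 * Z ^ 4 * 1 := by rw [hR]; ring
      _ ≤ 9 * K ^ 2 * Z ^ 4 * (κ ^ (-(1 / 7 : ℝ)) * (δ ^ ((1 : ℝ) / 7) * Z ^ 7)) := by gcongr
      _ = V * W := by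
        have : Z ^ (11 : ℝ) = Z ^ 4 * Z ^ 7 := by rw [← pow_add]; exact_mod_cast Real.rpow_natCast Z 11
        rw [hV, hW, this]
        ring
  · rw [hκ, lt_div_iff₀ (by positivity)] at hsmall
    exact (hsmallcard (P := P) hK1 ha hD0 hδ hD hZ1 (fun i => by linarith [hPZ i]) s
      (fun p hp => ⟨(hbd p (hsS p hp)).1, (hbd p (hsS p hp)).2, hSP p (hsS p hp)⟩)
      hsmall).imp_right Or.inl
end

section
/- There exists a constant C > 0 such that for every prime p and all real numbers a and b, setting c = (p² + 2p³)·a² − a⁴ + p²·b + a²·b + b² − p⁶, one has |a| + p^(−3/2)·|b| + p^(−9/2)·|c| ≥ C · p^(3/2). -/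
/-- The scale-invariant form of the amplifier inequality, with `t` in the role of `1 / p`. -/
lemma normalized_amplifier_inequality {t : ℝ} (ht0 : 0 ≤ t) (ht1 : t ≤ 1) (x y : ℝ) :
    1 / 10 ≤ |x| + |y| + |(2 + t) * x ^ 2 - x ^ 4 + t * y + x ^ 2 * y + y ^ 2 - 1| := by
  by_contra! h
  have hx0 := abs_nonneg x
  have hy0 := abs_nonneg y
  have hc0 := abs_nonneg ((2 + t) * x ^ 2 - x ^ 4 + t * y + x ^ 2 * y + y ^ 2 - 1)
  have hx2 : x ^ 2 ≤ 1 / 100 := by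
    rw [← sq_abs]
    nlinarith
  have hy2 : y ^ 2 ≤ 1 / 100 := by
    rw [← sq_abs]
    nlinarith
  have hy : y ≤ 1 / 10 := by linarith [le_abs_self y]
  have hty : t * y ≤ 1 / 10 := by nlinarith
  have htx : t * x ^ 2 ≤ 1 / 100 := by nlinarith [sq_nonneg x]
  have hxy : x ^ 2 * y ≤ 1 / 100 := by nlinarith [sq_nonneg x]
  have hx4 : 0 ≤ x ^ 4 := by positivity
  linarith [neg_le_abs ((2 + t) * x ^ 2 - x ^ 4 + t * y + x ^ 2 * y + y ^ 2 - 1)]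

theorem amplifier_inequality :
    ∃ C : ℝ, 0 < C ∧
      ∀ p : ℕ, p.Prime → ∀ a b : ℝ,
        |a| + (p : ℝ) ^ (-(3 : ℝ)/2) * |b|
          + (p : ℝ) ^ (-(9 : ℝ)/2) *
            |((p : ℝ) ^ 2 + 2 * (p : ℝ) ^ 3) * a ^ 2 - a ^ 4 + (p : ℝ) ^ 2 * b
              + a ^ 2 * b + b ^ 2 - (p : ℝ) ^ 6|
          ≥ C * (p : ℝ) ^ ((3 : ℝ)/2) := by
  refine ⟨1 / 10, by norm_num, fun p hp a b => ?_⟩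
  have hp1 : (1 : ℝ) ≤ p := by exact_mod_cast hp.one_le
  have hp0 : (0 : ℝ) < p := by linarith
  generalize (p : ℝ) = r at *
  have hb : r ^ (-(3 : ℝ) / 2) = (r ^ ((3 : ℝ) / 2))⁻¹ := by
    rw [← Real.rpow_neg hp0.le]
    norm_num
  have hc : r ^ (-(9 : ℝ) / 2) = ((r ^ ((3 : ℝ) / 2)) ^ 3)⁻¹ := by
    rw [← Real.rpow_mul_natCast hp0.le, ← Real.rpow_neg hp0.le]
    norm_num
  have hq : (r ^ ((3 : ℝ) / 2)) ^ 2 = r ^ 3 := by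
    rw [← Real.rpow_mul_natCast hp0.le, ← Real.rpow_natCast]
    norm_num
  have hq0 : 0 < r ^ ((3 : ℝ) / 2) := Real.rpow_pos_of_pos hp0 _
  rw [hb, hc]
  generalize r ^ ((3 : ℝ) / 2) = q at *
  obtain ⟨x, rfl⟩ : ∃ x, a = q * x := ⟨a / q, by field_simp⟩
  obtain ⟨y, rfl⟩ : ∃ y, b = q ^ 2 * y := ⟨b / q ^ 2, by field_simp⟩
  have hr2 : r ^ 2 = q ^ 2 * r⁻¹ := by
    rw [hq]
    field_simp
  have hr6 : r ^ 6 = q ^ 4 := by linear_combination (-(q ^ 2) - r ^ 3) * hq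
  have key : (r ^ 2 + 2 * r ^ 3) * (q * x) ^ 2 - (q * x) ^ 4 + r ^ 2 * (q ^ 2 * y)
      + (q * x) ^ 2 * (q ^ 2 * y) + (q ^ 2 * y) ^ 2 - r ^ 6
      = q ^ 4 * ((2 + r⁻¹) * x ^ 2 - x ^ 4 + r⁻¹ * y + x ^ 2 * y + y ^ 2 - 1) := by
    rw [hr6, hr2, ← hq]
    ring
  have hnorm := normalized_amplifier_inequality (inv_nonneg.2 hp0.le) (inv_le_one_of_one_le₀ hp1) x y
  rw [key, abs_mul, abs_mul, abs_mul, abs_of_pos hq0, abs_of_pos (pow_pos hq0 2),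
    abs_of_pos (pow_pos hq0 4)]
  generalize |(2 + r⁻¹) * x ^ 2 - x ^ 4 + r⁻¹ * y + x ^ 2 * y + y ^ 2 - 1| = z at *
  calc 1 / 10 * q ≤ (|x| + |y| + z) * q := by gcongr
    _ = q * |x| + q⁻¹ * (q ^ 2 * |y|) + (q ^ 3)⁻¹ * (q ^ 4 * z) := by field_simp
end

section
/- Let m₁ and m₂ be coprime positive integers. Suppose {A_i}_{i∈I} ⊆ S(m₁) and {B_j}_{j∈J} ⊆ S(m₂) are complete systems of representatives for the left cosets, i.e., S(m₁) is the disjoint union over i ∈ I of the sets Γ·A_i, and S(m₂) is the disjoint union over j ∈ J of the sets Γ·B_j. Then the products A_i·B_j form a complete system of representatives for the left cosets of Γ in S(m₁m₂): every M ∈ S(m₁m₂) satisfies M ∈ Γ·(A_i·B_j) for exactly one pair (i, j) ∈ I × J. -/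
open Matrix

noncomputable section

/-- The standard symplectic form matrix `J = ((0, I₂), (−I₂, 0))`. -/
def Jmat : Matrix (Fin 4) (Fin 4) ℝ := !![0, 0, 1, 0; 0, 0, 0, 1; -1, 0, 0, 0; 0, -1, 0, 0]

/-- `Sp₄(ℝ)`: real matrices with `Mᵀ J M = J`. -/
def Sp4 : Set (Matrix (Fin 4) (Fin 4) ℝ) := {M | Mᵀ * Jmat * M = Jmat}

/-- `S(m)`: integral matrices with `Mᵀ J M = m·J`. -/
def Smat (m : ℕ) : Set (Matrix (Fin 4) (Fin 4) ℤ) :=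
  {M | (M.map (Int.cast : ℤ → ℝ))ᵀ * Jmat * (M.map (Int.cast : ℤ → ℝ)) = (m : ℝ) • Jmat}

/-- `K = Sp₄(ℝ) ∩ O(4)`. -/
def Ksp : Set (Matrix (Fin 4) (Fin 4) ℝ) := {k | k ∈ Sp4 ∧ kᵀ * k = 1}

/-- `𝒮(g)_δ[m]`: the elements `γ ∈ S(m)` with `m^(−1/2) γ` within `δ` (entrywise)
of `g K g⁻¹`. -/
def Sball (g : Matrix (Fin 4) (Fin 4) ℝ) (δ : ℝ) (m : ℕ) :
    Set (Matrix (Fin 4) (Fin 4) ℤ) :=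
  {γ | γ ∈ Smat m ∧ ∃ k ∈ Ksp, ∀ i j,
    |(m : ℝ) ^ (-(1 : ℝ)/2) * (γ.map (Int.cast : ℤ → ℝ)) i j - (g * k * g⁻¹) i j| ≤ δ}

/-- The standard symplectic form matrix over `ℤ`. -/
def intJ : Matrix (Fin 4) (Fin 4) ℤ := !![0, 0, 1, 0; 0, 0, 0, 1; -1, 0, 0, 0; 0, -1, 0, 0]

lemma intJ_map : intJ.map (Int.cast : ℤ → ℝ) = Jmat := by
  ext i j
  fin_cases i <;> fin_cases j <;> simp [intJ, Jmat]

lemma intJ_mul_self : intJ * intJ = -1 := by decide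

lemma intJ_transpose : intJᵀ = -intJ := by decide

lemma mem_Smat_iff {m : ℕ} {M : Matrix (Fin 4) (Fin 4) ℤ} :
    M ∈ Smat m ↔ Mᵀ * intJ * M = (m : ℤ) • intJ := by
  have hinj : Function.Injective
      (fun X : Matrix (Fin 4) (Fin 4) ℤ => X.map (Int.cast : ℤ → ℝ)) :=
    Matrix.map_injective Int.cast_injective
  rw [← hinj.eq_iff, Smat, Set.mem_ofPred_eq]
  have h1 : (Mᵀ * intJ * M).map (Int.cast : ℤ → ℝ)
      = (M.map (Int.cast : ℤ → ℝ))ᵀ * Jmat * M.map (Int.cast : ℤ → ℝ) := by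
    rw [← intJ_map, Matrix.map_mul_intCast, Matrix.map_mul_intCast, Matrix.transpose_map]
  have h2 : ((m : ℤ) • intJ).map (Int.cast : ℤ → ℝ) = (m : ℝ) • Jmat := by
    rw [← intJ_map]
    ext i j
    simp only [Matrix.map_apply, Matrix.smul_apply, smul_eq_mul, Int.cast_mul, Int.cast_natCast]
  simp only [h1, h2]

section Cancellation

variable {n : Type*} [Fintype n] [DecidableEq n]

lemma eq_zero_of_mul_eq_zero_of_det_ne_zero {X B : Matrix n n ℤ} (hB : B.det ≠ 0)
    (h : X * B = 0) : X = 0 := by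
  have h2 : X * B * B.adjugate = 0 := by rw [h, zero_mul]
  rw [mul_assoc, Matrix.mul_adjugate, mul_smul_comm, mul_one] at h2
  exact (smul_eq_zero.mp h2).resolve_left hB

lemma eq_of_mul_eq_mul_of_det_ne_zero {X Y B : Matrix n n ℤ} (hB : B.det ≠ 0)
    (h : X * B = Y * B) : X = Y :=
  sub_eq_zero.mp (eq_zero_of_mul_eq_zero_of_det_ne_zero hB (by rw [sub_mul, h, sub_self]))

lemma det_ne_zero_of_mul_eq_smul_one {A B : Matrix n n ℤ} {m : ℤ} (hm : m ≠ 0)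
    (h : A * B = m • 1) : B.det ≠ 0 := by
  intro h0
  have h1 := congrArg Matrix.det h
  rw [Matrix.det_mul, h0, mul_zero, Matrix.det_smul, Matrix.det_one, mul_one] at h1
  exact pow_ne_zero _ hm h1.symm

lemma mul_eq_smul_one_comm {A B : Matrix n n ℤ} {m : ℤ} (hm : m ≠ 0)
    (h : A * B = m • 1) : B * A = m • 1 := by
  apply eq_of_mul_eq_mul_of_det_ne_zero (det_ne_zero_of_mul_eq_smul_one hm h)
  rw [mul_assoc, h, mul_smul_comm, smul_mul_assoc, mul_one, one_mul]

/-- A basis matrix `N` of the lattice spanned by the rows of `M` and of `m • 1`. -/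
lemma exists_common_right_divisor (M : Matrix n n ℤ) {m : ℤ} (hm : m ≠ 0) :
    ∃ N U V P Q : Matrix n n ℤ, N = U * M + m • V ∧ M = P * N ∧ Q * N = m • 1 := by
  let φ : ((n → ℤ) × (n → ℤ)) →ₗ[ℤ] (n → ℤ) :=
    (Matrix.vecMulLinear M).coprod (m • LinearMap.id)
  have hφ : ∀ x y, φ (x, y) = x ᵥ* M + m • y := fun x y => by simp [φ]
  let L : Submodule ℤ (n → ℤ) := LinearMap.range φ
  have hrank : Module.finrank ℤ L = Fintype.card n := by
    apply le_antisymm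
    · simpa using Submodule.finrank_le L
    · let ψ : (n → ℤ) →ₗ[ℤ] L :=
        (m • LinearMap.id : (n → ℤ) →ₗ[ℤ] (n → ℤ)).codRestrict L
          (fun y => ⟨(0, y), by simp [hφ]⟩)
      have hψ : Function.Injective ψ := by
        intro x y hxy
        have h := congrArg Subtype.val hxy
        exact smul_right_injective _ hm h
      simpa using LinearMap.finrank_le_finrank_of_injective hψ
  let b : Module.Basis n ℤ L :=
    (Module.finBasisOfFinrankEq ℤ L hrank).reindex (Fintype.equivFin n).symm
  have hmem : ∀ i, ∃ p : (n → ℤ) × (n → ℤ), φ p = (b i : n → ℤ) := fun i => (b i).2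
  choose p hp using hmem
  have hcomb : ∀ X : Matrix n n ℤ, (∀ i, X i ∈ L) →
      ∃ P : Matrix n n ℤ, X = P * Matrix.of (fun i => (b i : n → ℤ)) := by
    intro X hX
    refine ⟨Matrix.of fun i k => b.repr ⟨X i, hX i⟩ k, ?_⟩
    ext i j
    have h := congrArg (fun v : L => (v : n → ℤ) j) (b.sum_repr ⟨X i, hX i⟩)
    simp only [Submodule.coe_sum, Submodule.coe_smul, Finset.sum_apply, Pi.smul_apply,
      smul_eq_mul] at h
    simpa only [Matrix.mul_apply, Matrix.of_apply] using h.symm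
  obtain ⟨P, hP⟩ := hcomb M (fun i => ⟨(Pi.single i 1, 0), by simp [hφ]; rfl⟩)
  obtain ⟨Q, hQ⟩ := hcomb (m • 1) (fun i => ⟨(0, (1 : Matrix n n ℤ) i), by
    rw [hφ, Matrix.zero_vecMul, zero_add]; rfl⟩)
  refine ⟨Matrix.of (fun i => (b i : n → ℤ)), Matrix.of fun i => (p i).1,
    Matrix.of fun i => (p i).2, P, Q, ?_, hP, hQ.symm⟩
  ext i j
  have h := congrFun (hp i) j
  rw [← Prod.mk.eta (p := p i), hφ] at h
  simpa [Matrix.mul_apply, Matrix.vecMul, dotProduct] using h.symm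

end Cancellation

lemma exists_rotation (x y : ℤ) :
    ∃ p q r s : ℤ, p * s - q * r = 1 ∧ r * x + s * y = 0 := by
  by_cases hg : Int.gcd x y = 0
  · obtain ⟨rfl, rfl⟩ := Int.gcd_eq_zero_iff.mp hg
    exact ⟨1, 0, 0, 1, by simp, by simp⟩
  · obtain ⟨x', hx⟩ := Int.gcd_dvd_left x y
    obtain ⟨y', hy⟩ := Int.gcd_dvd_right x y
    have hb := Int.gcd_eq_gcd_ab x y
    have hg' : (Int.gcd x y : ℤ) ≠ 0 := by exact_mod_cast hg
    set g : ℤ := (Int.gcd x y : ℤ)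
    refine ⟨Int.gcdA x y, Int.gcdB x y, -y', x', ?_, ?_⟩
    · apply mul_left_cancel₀ hg'
      linear_combination (-(Int.gcdA x y)) * hx - (Int.gcdB x y) * hy - hb
    · linear_combination (-y') * hx + x' * hy

/-- The alternating `4 × 4` matrix with the given entries above the diagonal. -/
def altMatrix (a b c d e f : ℤ) : Matrix (Fin 4) (Fin 4) ℤ :=
  !![0, a, b, c; -a, 0, d, e; -b, -d, 0, f; -c, -e, -f, 0]

lemma eq_altMatrix {F : Matrix (Fin 4) (Fin 4) ℤ} (hF : Fᵀ = -F) :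
    F = altMatrix (F 0 1) (F 0 2) (F 0 3) (F 1 2) (F 1 3) (F 2 3) := by
  have h : ∀ i j, F j i = -F i j := fun i j => congrFun (congrFun hF i) j
  ext i j
  fin_cases i <;> fin_cases j <;> simp [altMatrix] <;>
    first
    | exact h _ _
    | (have h0 := h 0 0; have h1 := h 1 1; have h2 := h 2 2; have h3 := h 3 3; omega)

lemma det_altMatrix (a b c d e f : ℤ) :
    (altMatrix a b c d e f).det = (a * f - b * e + c * d) ^ 2 := by
  simp [altMatrix, Matrix.det_succ_row_zero, Fin.sum_univ_succ, Fin.succAbove]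
  ring

/-- Two integral bilinear forms are congruent if they differ by a change of basis. -/
def IntCongruent (F F' : Matrix (Fin 4) (Fin 4) ℤ) : Prop :=
  ∃ G H : Matrix (Fin 4) (Fin 4) ℤ, H * G = 1 ∧ G * F * Gᵀ = F'

lemma IntCongruent.trans {F F' F'' : Matrix (Fin 4) (Fin 4) ℤ}
    (h : IntCongruent F F') (h' : IntCongruent F' F'') : IntCongruent F F'' := by
  obtain ⟨G, H, hG, rfl⟩ := h
  obtain ⟨G', H', hG', rfl⟩ := h'
  refine ⟨G' * G, H * H', ?_, ?_⟩
  · rw [mul_assoc, ← mul_assoc H', hG', one_mul, hG]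
  · simp only [Matrix.transpose_mul, mul_assoc]

lemma IntCongruent.isUnit_det {F F' : Matrix (Fin 4) (Fin 4) ℤ}
    (h : IntCongruent F F') (hF : IsUnit F.det) : IsUnit F'.det := by
  obtain ⟨G, H, hG, rfl⟩ := h
  have hu : IsUnit G.det := Matrix.isUnit_det_of_left_inverse hG
  rw [Matrix.det_mul, Matrix.det_mul, Matrix.det_transpose]
  exact (hu.mul hF).mul hu

lemma exists_congruent_third_eq_zero (a b c d e f : ℤ) :
    ∃ b' d' e' f', IntCongruent (altMatrix a b c d e f) (altMatrix a b' 0 d' e' f') := by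
  obtain ⟨p, q, r, s, hdet, h0⟩ := exists_rotation b c
  refine ⟨p * b + q * c, p * d + q * e, r * d + s * e, f,
    !![1, 0, 0, 0; 0, 1, 0, 0; 0, 0, p, q; 0, 0, r, s],
    !![1, 0, 0, 0; 0, 1, 0, 0; 0, 0, s, -q; 0, 0, -r, p], ?_, ?_⟩
  · ext i j
    fin_cases i <;> fin_cases j <;> simp [Matrix.mul_apply, Fin.sum_univ_four] <;> grind
  · ext i j
    fin_cases i <;> fin_cases j <;>
      simp [altMatrix, Matrix.mul_apply, Fin.sum_univ_four] <;> grind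

lemma exists_congruent_second_eq_zero (a b d e f : ℤ) :
    ∃ a' d' e' f', IntCongruent (altMatrix a b 0 d e f) (altMatrix a' 0 0 d' e' f') := by
  obtain ⟨p, q, r, s, hdet, h0⟩ := exists_rotation a b
  refine ⟨p * a + q * b, d, p * e + q * f, r * e + s * f,
    !![1, 0, 0, 0; 0, p, q, 0; 0, r, s, 0; 0, 0, 0, 1],
    !![1, 0, 0, 0; 0, s, -q, 0; 0, -r, p, 0; 0, 0, 0, 1], ?_, ?_⟩
  · ext i j
    fin_cases i <;> fin_cases j <;> simp [Matrix.mul_apply, Fin.sum_univ_four] <;> grind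
  · ext i j
    fin_cases i <;> fin_cases j <;>
      simp [altMatrix, Matrix.mul_apply, Fin.sum_univ_four] <;> grind

lemma congruent_intJ_of_mul_self {a f : ℤ} (d e : ℤ) (ha : a * a = 1) (hf : f * f = 1) :
    IntCongruent (altMatrix a 0 0 d e f) intJ := by
  refine ⟨!![1, 0, 0, 0; a * d, 0, 1, 0; 0, a, 0, 0; f * a * e, 0, 0, f],
    !![1, 0, 0, 0; 0, 0, a, 0; -a * d, 1, 0, 0; -a * e, 0, 0, f], ?_, ?_⟩
  · ext i j
    fin_cases i <;> fin_cases j <;> simp [Matrix.mul_apply, Fin.sum_univ_four] <;> grind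
  · ext i j
    fin_cases i <;> fin_cases j <;>
      simp [altMatrix, intJ, Matrix.mul_apply, Fin.sum_univ_four] <;> grind

/-- A unimodular alternating form on `ℤ⁴` has a symplectic basis. -/
lemma congruent_intJ {F : Matrix (Fin 4) (Fin 4) ℤ} (hF : Fᵀ = -F) (hu : IsUnit F.det) :
    IntCongruent F intJ := by
  rw [eq_altMatrix hF] at hu ⊢
  obtain ⟨b, d, e, f, h1⟩ := exists_congruent_third_eq_zero (F 0 1) (F 0 2) (F 0 3)
    (F 1 2) (F 1 3) (F 2 3)
  obtain ⟨a', d', e', f', h2⟩ := exists_congruent_second_eq_zero (F 0 1) b d e f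
  have h := h1.trans h2
  have hu' := h.isUnit_det hu
  rw [det_altMatrix, isUnit_pow_iff two_ne_zero] at hu'
  simp only [zero_mul, sub_zero, add_zero] at hu'
  rw [IsUnit.mul_iff] at hu'
  exact h.trans (congruent_intJ_of_mul_self d' e' (Int.isUnit_mul_self hu'.1)
    (Int.isUnit_mul_self hu'.2))

/-- Elements of `S(m)` divide `m` on both sides. -/
lemma symplectic_adjoint_mul {m : ℕ} {M : Matrix (Fin 4) (Fin 4) ℤ} (hM : M ∈ Smat m) :
    (-(intJ * Mᵀ * intJ)) * M = (m : ℤ) • 1 := by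
  rw [mem_Smat_iff] at hM
  calc (-(intJ * Mᵀ * intJ)) * M = -(intJ * (Mᵀ * intJ * M)) := by noncomm_ring
    _ = (m : ℤ) • 1 := by rw [hM, mul_smul_comm, intJ_mul_self, smul_neg, neg_neg]

lemma det_ne_zero_of_mem_Smat {m : ℕ} (hm : 0 < m) {M : Matrix (Fin 4) (Fin 4) ℤ}
    (hM : M ∈ Smat m) : M.det ≠ 0 :=
  det_ne_zero_of_mul_eq_smul_one (by exact_mod_cast hm.ne') (symplectic_adjoint_mul hM)

lemma mul_intJ_mul_transpose {m : ℕ} (hm : 0 < m) {M : Matrix (Fin 4) (Fin 4) ℤ}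
    (hM : M ∈ Smat m) : M * intJ * Mᵀ = (m : ℤ) • intJ := by
  have h := mul_eq_smul_one_comm (by exact_mod_cast hm.ne') (symplectic_adjoint_mul hM)
  calc M * intJ * Mᵀ = (M * -(intJ * Mᵀ * intJ)) * intJ := by
        simp only [mul_neg, neg_mul, mul_assoc, intJ_mul_self, mul_one, neg_neg]
    _ = (m : ℤ) • intJ := by rw [h, smul_mul_assoc, one_mul]

lemma transpose_mem_Smat_iff {m : ℕ} (hm : 0 < m) {M : Matrix (Fin 4) (Fin 4) ℤ} :
    Mᵀ ∈ Smat m ↔ M ∈ Smat m := by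
  have key : ∀ {X : Matrix (Fin 4) (Fin 4) ℤ}, X ∈ Smat m → Xᵀ ∈ Smat m := fun hX => by
    rw [mem_Smat_iff, Matrix.transpose_transpose]
    exact mul_intJ_mul_transpose hm hX
  exact ⟨fun h => by simpa using key h, key⟩

lemma mul_mem_Smat {m k : ℕ} {X Y : Matrix (Fin 4) (Fin 4) ℤ} (hX : X ∈ Smat m)
    (hY : Y ∈ Smat k) : X * Y ∈ Smat (m * k) := by
  rw [mem_Smat_iff] at *
  calc (X * Y)ᵀ * intJ * (X * Y) = Yᵀ * (Xᵀ * intJ * X) * Y := by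
        simp only [Matrix.transpose_mul, mul_assoc]
    _ = ((m * k : ℕ) : ℤ) • intJ := by
        rw [hX, mul_smul_comm, smul_mul_assoc, hY, smul_smul, Nat.cast_mul]

lemma mem_Smat_of_mul_mem {m k : ℕ} (hk : 0 < k) {X Y : Matrix (Fin 4) (Fin 4) ℤ}
    (hXY : X * Y ∈ Smat (m * k)) (hY : Y ∈ Smat k) : X ∈ Smat m := by
  have hd := det_ne_zero_of_mem_Smat hk hY
  rw [mem_Smat_iff] at *
  apply eq_of_mul_eq_mul_of_det_ne_zero hd
  apply Matrix.transpose_injective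
  apply eq_of_mul_eq_mul_of_det_ne_zero hd
  apply Matrix.transpose_injective
  simp only [Matrix.transpose_mul, Matrix.transpose_transpose, Matrix.transpose_smul] at *
  have h2 : Yᵀ * ((m : ℤ) • intJ * Y) = ((m * k : ℕ) : ℤ) • intJ := by
    rw [smul_mul_assoc, mul_smul_comm, ← mul_assoc, hY, smul_smul, Nat.cast_mul]
  rw [h2, ← hXY]
  simp only [mul_assoc]

/-- Elements of `S(m₁m₂)` factor when `m₁` and `m₂` are coprime. -/
lemma exists_factorization {m₁ m₂ : ℕ} (h₁ : 0 < m₁) (h₂ : 0 < m₂) (hco : Nat.Coprime m₁ m₂)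
    {M : Matrix (Fin 4) (Fin 4) ℤ} (hM : M ∈ Smat (m₁ * m₂)) :
    ∃ X ∈ Smat m₁, ∃ Y ∈ Smat m₂, M = X * Y := by
  have hz₁ : (m₁ : ℤ) ≠ 0 := by exact_mod_cast h₁.ne'
  have hz₂ : (m₂ : ℤ) ≠ 0 := by exact_mod_cast h₂.ne'
  obtain ⟨N, U, V, P, Q, hN, hP, hQ⟩ := exists_common_right_divisor M hz₂
  have hMJ := mul_intJ_mul_transpose (Nat.mul_pos h₁ h₂) hM
  obtain ⟨F, hF⟩ : ∃ F, N * intJ * Nᵀ = (m₂ : ℤ) • F := by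
    refine ⟨(m₁ : ℤ) • (U * intJ * Uᵀ) + U * M * intJ * Vᵀ + V * intJ * Mᵀ * Uᵀ
      + (m₂ : ℤ) • (V * intJ * Vᵀ), ?_⟩
    have hU : U * M * intJ * Mᵀ * Uᵀ = ((m₂ : ℤ) * m₁) • (U * intJ * Uᵀ) := by
      calc U * M * intJ * Mᵀ * Uᵀ = U * (M * intJ * Mᵀ) * Uᵀ := by simp only [mul_assoc]
        _ = _ := by
          rw [hMJ, mul_smul_comm, smul_mul_assoc, Nat.cast_mul, mul_comm (m₁ : ℤ)]
    rw [hN]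
    simp only [Matrix.transpose_add, Matrix.transpose_mul, Matrix.transpose_smul, add_mul,
      mul_add, smul_add, smul_mul_assoc, mul_smul_comm, smul_smul]
    simp only [← mul_assoc, hU]
    abel
  have hFt : Fᵀ = -F := by
    apply smul_right_injective _ hz₂
    change (m₂ : ℤ) • Fᵀ = (m₂ : ℤ) • -F
    rw [← Matrix.transpose_smul, smul_neg, ← hF]
    simp [Matrix.transpose_mul, intJ_transpose, mul_assoc]
  have hR₂ : F * -(Qᵀ * intJ * Q) = (m₂ : ℤ) • 1 := by
    apply smul_right_injective _ hz₂
    change (m₂ : ℤ) • (F * -(Qᵀ * intJ * Q)) = (m₂ : ℤ) • ((m₂ : ℤ) • 1)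
    have hQt : Nᵀ * Qᵀ = (m₂ : ℤ) • 1 := by
      rw [← Matrix.transpose_mul, hQ, Matrix.transpose_smul, Matrix.transpose_one]
    rw [← smul_mul_assoc, ← hF]
    calc N * intJ * Nᵀ * -(Qᵀ * intJ * Q) = -(N * intJ * (Nᵀ * Qᵀ) * intJ * Q) := by
          noncomm_ring
      _ = -((m₂ : ℤ) • (N * (intJ * intJ) * Q)) := by
          rw [hQt]; simp only [mul_smul_comm, smul_mul_assoc, mul_one, mul_assoc]
      _ = (m₂ : ℤ) • ((m₂ : ℤ) • 1) := by
          rw [intJ_mul_self, mul_neg, neg_mul, mul_one, mul_eq_smul_one_comm hz₂ hQ, smul_neg,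
            neg_neg]
  have hPF : P * F * Pᵀ = (m₁ : ℤ) • intJ := by
    apply smul_right_injective _ hz₂
    change (m₂ : ℤ) • (P * F * Pᵀ) = (m₂ : ℤ) • ((m₁ : ℤ) • intJ)
    rw [← smul_mul_assoc, ← mul_smul_comm, ← hF, smul_smul, mul_comm (m₂ : ℤ), ← Nat.cast_mul,
      ← hMJ]
    conv_rhs => rw [hP]
    simp only [Matrix.transpose_mul, mul_assoc]
  have hR₁ : F * -(Pᵀ * intJ * P) = (m₁ : ℤ) • 1 := by
    have h : P * -(F * Pᵀ * intJ) = (m₁ : ℤ) • 1 := by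
      calc P * -(F * Pᵀ * intJ) = -(P * F * Pᵀ * intJ) := by noncomm_ring
        _ = (m₁ : ℤ) • 1 := by rw [hPF, smul_mul_assoc, intJ_mul_self, smul_neg, neg_neg]
    rw [← mul_eq_smul_one_comm hz₁ h]
    noncomm_ring
  have hunit : IsUnit F.det := by
    obtain ⟨u, v, huv⟩ := Nat.isCoprime_iff_coprime.mpr hco
    apply Matrix.isUnit_det_of_right_inverse
      (B := u • -(Pᵀ * intJ * P) + v • -(Qᵀ * intJ * Q))
    rw [mul_add, mul_smul_comm, mul_smul_comm, hR₁, hR₂, smul_smul, smul_smul, ← add_smul, huv,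
      one_smul]
  obtain ⟨G, H, hHG, hG⟩ := congruent_intJ hFt hunit
  have hY : G * N ∈ Smat m₂ := by
    rw [← transpose_mem_Smat_iff h₂, mem_Smat_iff, Matrix.transpose_transpose]
    calc G * N * intJ * (G * N)ᵀ = G * (N * intJ * Nᵀ) * Gᵀ := by
          simp only [Matrix.transpose_mul, mul_assoc]
      _ = (m₂ : ℤ) • intJ := by rw [hF, mul_smul_comm, smul_mul_assoc, hG]
  have hfac : M = P * H * (G * N) := by
    rw [mul_assoc, ← mul_assoc H, hHG, one_mul, ← hP]
  exact ⟨P * H, mem_Smat_of_mul_mem h₂ (hfac ▸ hM) hY, G * N, hY, hfac⟩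

/-- The right factor of a factorization is unique up to `Γ`. -/
lemma exists_eq_mul_of_mul_eq_mul {m₁ m₂ : ℕ} (h₂ : 0 < m₂) (hco : Nat.Coprime m₁ m₂)
    {X X' Y Y' : Matrix (Fin 4) (Fin 4) ℤ} (hX' : X' ∈ Smat m₁)
    (hY : Y ∈ Smat m₂) (hY' : Y' ∈ Smat m₂) (h : X * Y = X' * Y') :
    ∃ γ ∈ Smat 1, Y' = γ * Y := by
  obtain ⟨u, v, huv⟩ := Nat.isCoprime_iff_coprime.mpr hco
  have hfac : Y' = (u • (-(intJ * X'ᵀ * intJ) * X) + v • (Y' * -(intJ * Yᵀ * intJ))) * Y := by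
    rw [add_mul, smul_mul_assoc, smul_mul_assoc, mul_assoc _ X, h, ← mul_assoc _ X',
      symplectic_adjoint_mul hX', mul_assoc Y', symplectic_adjoint_mul hY, smul_mul_assoc,
      one_mul, mul_smul_comm, mul_one, smul_smul, smul_smul, ← add_smul, huv, one_smul]
  exact ⟨_, mem_Smat_of_mul_mem h₂ (by rwa [← hfac, one_mul]) hY, hfac⟩

theorem coset_representatives_multiply :
    ∀ m₁ m₂ : ℕ, 0 < m₁ → 0 < m₂ → Nat.Coprime m₁ m₂ →
      ∀ {I J : Type} (A : I → Matrix (Fin 4) (Fin 4) ℤ) (B : J → Matrix (Fin 4) (Fin 4) ℤ),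
        (∀ i, A i ∈ Smat m₁) →
        (∀ M ∈ Smat m₁, ∃! i : I, ∃ γ ∈ Smat 1, M = γ * A i) →
        (∀ j, B j ∈ Smat m₂) →
        (∀ M ∈ Smat m₂, ∃! j : J, ∃ γ ∈ Smat 1, M = γ * B j) →
        ∀ M ∈ Smat (m₁ * m₂), ∃! ij : I × J, ∃ γ ∈ Smat 1, M = γ * (A ij.1 * B ij.2) := by
  intro m₁ m₂ h₁ h₂ hco I J A B hA hAu hB hBu M hM
  have hone : (1 : Matrix (Fin 4) (Fin 4) ℤ) ∈ Smat 1 := by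
    rw [mem_Smat_iff]
    simp
  obtain ⟨X, hX, Y, hY, rfl⟩ := exists_factorization h₁ h₂ hco hM
  obtain ⟨j, ⟨γ, hγ, rfl⟩, -⟩ := hBu Y hY
  obtain ⟨i, ⟨γ', hγ', hi⟩, -⟩ := hAu (X * γ) (by simpa using mul_mem_Smat hX hγ)
  have hij : X * (γ * B j) = γ' * (A i * B j) := by rw [← mul_assoc, hi, mul_assoc]
  refine ⟨(i, j), ⟨γ', hγ', hij⟩, ?_⟩
  rintro ⟨i', j'⟩ ⟨δ, hδ, h⟩
  have hmem : ∀ {ε : Matrix (Fin 4) (Fin 4) ℤ}, ε ∈ Smat 1 → ∀ k, ε * A k ∈ Smat m₁ :=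
    fun hε k => by simpa using mul_mem_Smat hε (hA k)
  have heq : δ * A i' * B j' = γ' * A i * B j := by
    rw [mul_assoc, mul_assoc, ← h, hij]
  have hj : j' = j :=
    (hBu (B j) (hB j)).unique
      (exists_eq_mul_of_mul_eq_mul h₂ hco (hmem hγ' i) (hB j') (hB j) heq)
      ⟨1, hone, (one_mul _).symm⟩
  subst hj
  have hA' := eq_of_mul_eq_mul_of_det_ne_zero (det_ne_zero_of_mem_Smat h₂ (hB j')) heq
  have hi' : i' = i :=
    (hAu (δ * A i') (hmem hδ i')).unique ⟨δ, hδ, rfl⟩ ⟨γ', hγ', hA'⟩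
  rw [hi']
end
end
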